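/- Let D be a connected C-homogeneous digraph of Type II with more than one end. Then D contains no triangle. -/

import Mathlib

open Set

universe u

/-- The underlying undirected graph of a digraph given by its edge relation. -/
def UG {V : Type u} (E : V → V → Prop) : SimpleGraph V := SimpleGraph.fromRel E

/-- `E` is a digraph edge relation: irreflexive and antisymmetric. -/
def IsDigraph {V : Type u} (E : V → V → Prop) : Prop :=
  (∀ x, ¬ E x x) ∧ ∀ x y, E x y → ¬ E y x

/-- A ray in a graph: a one-way infinite path. -/
def IsRay {V : Type u} (G : SimpleGraph V) (r : ℕ → V) : Prop :=
  Function.Injective r ∧ ∀ n, G.Adj (r n) (r (n + 1))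

/-- A sequence is eventually in a set. -/
def EventuallyIn {V : Type u} (r : ℕ → V) (C : Set V) : Prop :=
  ∃ N, ∀ n, N ≤ n → r n ∈ C

/-- `C` is a connected component of the subgraph of `G` induced on `W`:
a maximal connected subset of `W`. -/
def IsCompOf {V : Type u} (G : SimpleGraph V) (C W : Set V) : Prop :=
  C.Nonempty ∧ C ⊆ W ∧ (G.induce C).Connected ∧
    ∀ C', C ⊆ C' → C' ⊆ W → (G.induce C').Connected → C' = C

/-- Two rays are equivalent if for every finite vertex set `S` they lie eventually
in the same component of the graph minus `S`. -/
def RayEquiv {V : Type u} (G : SimpleGraph V) (r r' : ℕ → V) : Prop :=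
  ∀ S : Finset V, ∃ C : Set V, IsCompOf G C {v | v ∉ S} ∧
    EventuallyIn r C ∧ EventuallyIn r' C

/-- The graph has more than one end: two inequivalent rays. -/
def MoreThanOneEnd {V : Type u} (G : SimpleGraph V) : Prop :=
  ∃ r r' : ℕ → V, IsRay G r ∧ IsRay G r' ∧ ¬ RayEquiv G r r'

/-- The graph has infinitely many ends: arbitrarily large families of pairwise
inequivalent rays. -/
def InfinitelyManyEnds {V : Type u} (G : SimpleGraph V) : Prop :=
  ∀ n : ℕ, ∃ f : Fin n → (ℕ → V), (∀ i, IsRay G (f i)) ∧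
    ∀ i j, i ≠ j → ¬ RayEquiv G (f i) (f j)

/-- A separation of a graph: a pair of vertex sets covering `V` such that every
edge lies within one side. -/
def IsSeparation {V : Type u} (G : SimpleGraph V) (c : Set V × Set V) : Prop :=
  c.1 ∪ c.2 = univ ∧ ∀ x y, G.Adj x y → (x ∈ c.1 ∧ y ∈ c.1) ∨ (x ∈ c.2 ∧ y ∈ c.2)

/-- The order of a separation: the number of vertices in its separator. -/
noncomputable def sepOrder {V : Type u} (c : Set V × Set V) : ℕ := (c.1 ∩ c.2).ncard

/-- The neighbourhood of a vertex set. -/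
def Nbhd {V : Type u} (G : SimpleGraph V) (A : Set V) : Set V :=
  {v | v ∉ A ∧ ∃ u ∈ A, G.Adj u v}

/-- The separation `(A, ∼)`. -/
def tildeSep {V : Type u} (G : SimpleGraph V) (A : Set V) : Set V × Set V :=
  (A, Aᶜ ∪ Nbhd G Aᶜ)

/-- `S` separates the wings of the separation `c`: every walk from one wing to
the other meets `S`. -/
def SeparatesWings {V : Type u} (G : SimpleGraph V) (c : Set V × Set V) (S : Set V) : Prop :=
  ∀ a ∈ c.1 \ c.2, ∀ b ∈ c.2 \ c.1, ∀ w : G.Walk a b, ∃ v ∈ w.support, v ∈ S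

/-- A separation of finite order with non-empty wings is essential if its first wing is
connected and no proper subset of the separator separates the wings. -/
def IsEssential {V : Type u} (G : SimpleGraph V) (c : Set V × Set V) : Prop :=
  IsSeparation G c ∧ (c.1 ∩ c.2).Finite ∧ (c.1 \ c.2).Nonempty ∧ (c.2 \ c.1).Nonempty ∧
  (G.induce (c.1 \ c.2)).Connected ∧
  ∀ S, S ⊂ c.1 ∩ c.2 → ¬ SeparatesWings G c S

/-- `C` is a wing of some separation in `𝒞`. -/
def IsWingOf {V : Type u} (𝒞 : Set (Set V × Set V)) (C : Set V) : Prop :=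
  ∃ d ∈ 𝒞, C = d.1 \ d.2 ∨ C = d.2 \ d.1

/-- A cut system. -/
def IsCutSystem {V : Type u} (G : SimpleGraph V) (𝒞 : Set (Set V × Set V)) : Prop :=
  𝒞.Nonempty ∧ (∀ c ∈ 𝒞, IsEssential G c) ∧
  (∀ c ∈ 𝒞, ∃ d ∈ 𝒞, d.1 ⊆ c.2) ∧
  (∀ c ∈ 𝒞, ∀ C : Set V, IsCompOf G C (c.2 \ c.1) →
    (∃ d ∈ 𝒞, d.1 \ d.2 ⊆ C) → tildeSep G (C ∪ Nbhd G C) ∈ 𝒞) ∧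
  (∀ c ∈ 𝒞, ∀ c' ∈ 𝒞, ∃ C₁ C₂ : Set V,
    ((IsCompOf G C₁ ((c.1 \ c.2) ∩ (c'.1 \ c'.2)) ∧
      IsCompOf G C₂ ((c.2 \ c.1) ∩ (c'.2 \ c'.1))) ∨
     (IsCompOf G C₁ ((c.2 \ c.1) ∩ (c'.1 \ c'.2)) ∧
      IsCompOf G C₂ ((c.1 \ c.2) ∩ (c'.2 \ c'.1)))) ∧
    IsWingOf 𝒞 C₁ ∧ IsWingOf 𝒞 C₂)

/-- Pick a side of a separation. -/
def pickSide {V : Type u} (c : Set V × Set V) : Bool → Set V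
  | false => c.1
  | true => c.2

/-- Two cuts are nested (with respect to the cut system `𝒞`). -/
def NestedPair {V : Type u} (G : SimpleGraph V) (𝒞 : Set (Set V × Set V))
    (c d : Set V × Set V) : Prop :=
  ∃ i j : Bool,
    ((¬ ∃ C, IsCompOf G C ((tildeSep G (pickSide c i ∩ pickSide d j)).1 \
        (tildeSep G (pickSide c i ∩ pickSide d j)).2) ∧
        tildeSep G (C ∪ Nbhd G C) ∈ 𝒞) ∨
     (¬ ∃ C, IsCompOf G C ((tildeSep G (pickSide c i ∩ pickSide d j)).2 \
        (tildeSep G (pickSide c i ∩ pickSide d j)).1) ∧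
        tildeSep G (C ∪ Nbhd G C) ∈ 𝒞)) ∧
    (c.1 ∩ c.2) ∪ (d.1 ∩ d.2) ⊆ pickSide c (!i) ∩ pickSide d (!j)

/-- A cut system is nested if each two of its cuts are nested. -/
def IsNestedSystem {V : Type u} (G : SimpleGraph V) (𝒞 : Set (Set V × Set V)) : Prop :=
  ∀ c ∈ 𝒞, ∀ d ∈ 𝒞, NestedPair G 𝒞 c d

/-- `S` is a `𝒞`-separator. -/
def IsSeparatorOf {V : Type u} (𝒞 : Set (Set V × Set V)) (S : Set V) : Prop :=
  ∃ c ∈ 𝒞, c.1 ∩ c.2 = S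

/-- A vertex set contains an end: some ray lies in it. -/
def ContainsEnd {V : Type u} (G : SimpleGraph V) (A : Set V) : Prop :=
  ∃ r : ℕ → V, IsRay G r ∧ ∀ n, r n ∈ A

/-- A basic cut system. -/
def IsBasic {V : Type u} (G : SimpleGraph V) (𝒞 : Set (Set V × Set V)) : Prop :=
  IsCutSystem G 𝒞 ∧
  (∀ c ∈ 𝒞, ∀ d ∈ 𝒞, ¬ sepOrder c < sepOrder d) ∧
  IsNestedSystem G 𝒞 ∧
  (∀ φ : G ≃g G, ∀ c ∈ 𝒞, ((⇑φ '' c.1, ⇑φ '' c.2) : Set V × Set V) ∈ 𝒞) ∧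
  (∀ S S' : Set V, IsSeparatorOf 𝒞 S → IsSeparatorOf 𝒞 S' → ∃ φ : G ≃g G, ⇑φ '' S = S') ∧
  (∀ c ∈ 𝒞, ContainsEnd G c.1 ∧ ContainsEnd G c.2 ∧
    ¬ ∃ d : Set V × Set V, IsSeparation G d ∧ (d.1 ∩ d.2).Finite ∧
      (d.1 ∩ d.2).ncard < sepOrder c ∧ ContainsEnd G d.1 ∧ ContainsEnd G d.2)

/-- The defining property of a `𝒞`-block. -/
def BlockProp {V : Type u} (𝒞 : Set (Set V × Set V)) (X : Set V) : Prop :=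
  (∀ c ∈ 𝒞, (X ⊆ c.1 ∨ X ⊆ c.2) ∧ ¬ (X ⊆ c.1 ∧ X ⊆ c.2)) ∧
  ∃ c ∈ 𝒞, X ⊆ c.1 ∧ c.1 ∩ c.2 ⊆ X

/-- A `𝒞`-block: a maximal vertex set with the block property. -/
def IsCBlock {V : Type u} (𝒞 : Set (Set V × Set V)) (X : Set V) : Prop :=
  BlockProp 𝒞 X ∧ ∀ X', X ⊆ X' → BlockProp 𝒞 X' → X' = X

/-- A digraph is C-homogeneous: every isomorphism between finite induced
subdigraphs with connected underlying graphs extends to an automorphism. -/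
def DigraphCHom {V : Type u} (E : V → V → Prop) : Prop :=
  ∀ (X Y : Set V), X.Finite → Y.Finite → ((UG E).induce X).Connected →
  ∀ φ : X ≃ Y, (∀ a b : X, E a.1 b.1 ↔ E (φ a).1 (φ b).1) →
  ∃ ψ : Equiv.Perm V, (∀ x y, E (ψ x) (ψ y) ↔ E x y) ∧ ∀ a : X, ψ a.1 = (φ a).1

/-- A graph is C-homogeneous: every isomorphism between finite connected induced
subgraphs extends to an automorphism. -/
def GraphCHom {V : Type u} (G : SimpleGraph V) : Prop :=
  ∀ (X Y : Set V), X.Finite → Y.Finite → (G.induce X).Connected →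
  ∀ φ : X ≃ Y, (∀ a b : X, G.Adj a.1 b.1 ↔ G.Adj (φ a).1 (φ b).1) →
  ∃ ψ : G ≃g G, ∀ a : X, ψ a.1 = (φ a).1

/-- The digraph contains a triangle: three pairwise adjacent vertices. -/
def HasTriangle {V : Type u} (E : V → V → Prop) : Prop :=
  ∃ x y z : V, (UG E).Adj x y ∧ (UG E).Adj y z ∧ (UG E).Adj x z

/-- An `n`-arc: a directed path `p 0, p 1, …, p n`. -/
def IsArc {V : Type u} (E : V → V → Prop) (n : ℕ) (p : ℕ → V) : Prop :=
  (∀ i j, i ≤ n → j ≤ n → p i = p j → i = j) ∧ ∀ i < n, E (p i) (p (i + 1))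

/-- A digraph is highly-arc-transitive: for every `n`, its automorphism group acts
transitively on `n`-arcs. -/
def HighlyArcTransitive {V : Type u} (E : V → V → Prop) : Prop :=
  ∀ n : ℕ, ∀ p q : ℕ → V, IsArc E n p → IsArc E n q →
  ∃ ψ : Equiv.Perm V, (∀ x y, E (ψ x) (ψ y) ↔ E x y) ∧ ∀ i ≤ n, ψ (p i) = q i

/-- An alternating walk `w 0, …, w n` in a digraph. -/
def IsAltWalk {V : Type u} (E : V → V → Prop) (n : ℕ) (w : ℕ → V) : Prop :=
  (∀ i < n, E (w i) (w (i + 1)) ∨ E (w (i + 1)) (w i)) ∧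
  ∀ i, i + 2 ≤ n → (E (w i) (w (i + 1)) ↔ E (w (i + 2)) (w (i + 1)))

/-- The edge `e` lies on the walk `w 0, …, w n` (in either direction). -/
def EdgeOnWalk {V : Type u} (n : ℕ) (w : ℕ → V) (e : V × V) : Prop :=
  ∃ i < n, (w i = e.1 ∧ w (i + 1) = e.2) ∨ (w i = e.2 ∧ w (i + 1) = e.1)

/-- Two edges are reachable from each other: they lie on a common alternating walk. -/
def Reach {V : Type u} (E : V → V → Prop) (e f : V × V) : Prop :=
  ∃ n w, IsAltWalk E n w ∧ EdgeOnWalk n w e ∧ EdgeOnWalk n w f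

/-- The edge relation of the reachability digraph `Δ_e`. -/
def DeltaRel {V : Type u} (E : V → V → Prop) (e : V × V) : V → V → Prop :=
  fun x y => E x y ∧ Reach E e (x, y)

/-- The underlying undirected graph of the reachability digraph `Δ_e`. -/
def DeltaGraph {V : Type u} (E : V → V → Prop) (e : V × V) : SimpleGraph V :=
  UG (DeltaRel E e)

/-- Tails of edges of `𝒜(e)`. -/
def Tails {V : Type u} (E : V → V → Prop) (e : V × V) : Set V :=
  {x | ∃ y, DeltaRel E e x y}

/-- Heads of edges of `𝒜(e)`. -/
def Heads {V : Type u} (E : V → V → Prop) (e : V × V) : Set V :=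
  {y | ∃ x, DeltaRel E e x y}

/-- The set of descendants of a vertex. -/
def Descendants {V : Type u} (E : V → V → Prop) (x : V) : Set V :=
  {y | ∃ n p, IsArc E n p ∧ p 0 = x ∧ p n = y}

/-- `(X, Y)` is a bipartition of the graph `G`. -/
def IsBipartition {V : Type u} (G : SimpleGraph V) (X Y : Set V) : Prop :=
  X ∪ Y = univ ∧ Disjoint X Y ∧
  ∀ a b, G.Adj a b → (a ∈ X ∧ b ∈ Y) ∨ (a ∈ Y ∧ b ∈ X)

/-- `G` with sides `X`, `Y` is C-homogeneous bipartite: every isomorphism between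
finite connected induced subgraphs preserving the sides extends to a side-preserving
automorphism. -/
def BipCHom {V : Type u} (G : SimpleGraph V) (X Y : Set V) : Prop :=
  ∀ (A B : Set V), A.Finite → B.Finite → (G.induce A).Connected →
  ∀ φ : A ≃ B, (∀ a b : A, G.Adj a.1 b.1 ↔ G.Adj (φ a).1 (φ b).1) →
  (∀ a : A, a.1 ∈ X ↔ (φ a).1 ∈ X) → (∀ a : A, a.1 ∈ Y ↔ (φ a).1 ∈ Y) →
  ∃ ψ : G ≃g G, (∀ v, v ∈ X ↔ ψ v ∈ X) ∧ (∀ v, v ∈ Y ↔ ψ v ∈ Y) ∧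
    ∀ a : A, ψ a.1 = (φ a).1

/-- `G` with sides `X`, `Y` is homogeneous bipartite: every isomorphism between
finite induced subgraphs preserving the sides extends to a side-preserving
automorphism. -/
def BipHom {V : Type u} (G : SimpleGraph V) (X Y : Set V) : Prop :=
  ∀ (A B : Set V), A.Finite → B.Finite →
  ∀ φ : A ≃ B, (∀ a b : A, G.Adj a.1 b.1 ↔ G.Adj (φ a).1 (φ b).1) →
  (∀ a : A, a.1 ∈ X ↔ (φ a).1 ∈ X) → (∀ a : A, a.1 ∈ Y ↔ (φ a).1 ∈ Y) →
  ∃ ψ : G ≃g G, (∀ v, v ∈ X ↔ ψ v ∈ X) ∧ (∀ v, v ∈ Y ↔ ψ v ∈ Y) ∧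
    ∀ a : A, ψ a.1 = (φ a).1

/-- `G` with sides `X`, `Y` is generic bipartite. -/
def GenericBip {V : Type u} (G : SimpleGraph V) (X Y : Set V) : Prop :=
  (∀ U W : Set V, U ⊆ X → W ⊆ X → U.Finite → W.Finite → Disjoint U W →
    ∃ v ∈ Y, (∀ u ∈ U, G.Adj v u) ∧ ∀ w ∈ W, ¬ G.Adj v w) ∧
  (∀ U W : Set V, U ⊆ Y → W ⊆ Y → U.Finite → W.Finite → Disjoint U W →
    ∃ v ∈ X, (∀ u ∈ U, G.Adj v u) ∧ ∀ w ∈ W, ¬ G.Adj v w)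

/-- `u` and `v` are joined by a walk of `G` avoiding `T`. -/
def LinkedOff {V : Type u} (G : SimpleGraph V) (T : Set V) (u v : V) : Prop :=
  ∃ p : G.Walk u v, ∀ z ∈ p.support, z ∉ T

namespace LinkedOff

variable {V : Type u} {G : SimpleGraph V} {T T' : Set V} {u v w : V}

lemma refl (h : u ∉ T) : LinkedOff G T u u := ⟨.nil, by simpa using h⟩

lemma left (h : LinkedOff G T u v) : u ∉ T := by
  obtain ⟨p, hp⟩ := h
  exact hp _ p.start_mem_support

lemma right (h : LinkedOff G T u v) : v ∉ T := by
  obtain ⟨p, hp⟩ := h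
  exact hp _ p.end_mem_support

lemma symm (h : LinkedOff G T u v) : LinkedOff G T v u := by
  obtain ⟨p, hp⟩ := h
  exact ⟨p.reverse, by simpa using hp⟩

lemma trans (h : LinkedOff G T u v) (h' : LinkedOff G T v w) : LinkedOff G T u w := by
  obtain ⟨p, hp⟩ := h
  obtain ⟨q, hq⟩ := h'
  refine ⟨p.append q, fun z hz => ?_⟩
  rcases (SimpleGraph.Walk.mem_support_append_iff _ _).1 hz with h | h
  exacts [hp z h, hq z h]

lemma edge (h : G.Adj u v) (hu : u ∉ T) (hv : v ∉ T) : LinkedOff G T u v :=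
  ⟨h.toWalk, by simp [hu, hv]⟩

lemma step (h : LinkedOff G T u v) (hvw : G.Adj v w) (hw : w ∉ T) : LinkedOff G T u w :=
  h.trans (edge hvw h.right hw)

lemma mem_of_closed {X : Set V} (hX : ∀ a ∈ X, ∀ b, G.Adj a b → b ∉ T → b ∈ X)
    (h : LinkedOff G T u v) (hu : u ∈ X) : v ∈ X := by
  obtain ⟨p, hp⟩ := h
  induction p with
  | nil => exact hu
  | cons h p ih =>
    simp only [SimpleGraph.Walk.support_cons, List.mem_cons, forall_eq_or_imp] at hp
    exact ih (hX _ hu _ h (hp.2 _ p.start_mem_support)) hp.2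

lemma mono (hT : T' ⊆ T) (h : LinkedOff G T u v) : LinkedOff G T' u v := by
  obtain ⟨p, hp⟩ := h
  exact ⟨p, fun z hz hz' => hp z hz (hT hz')⟩

lemma of_avoids (h : LinkedOff G T u v) (hT : ∀ w, LinkedOff G T u w → w ∉ T') :
    LinkedOff G T' u v := by
  have hu := hT u (refl h.left)
  refine (mem_of_closed (X := {w | LinkedOff G T u w ∧ LinkedOff G T' u w}) ?_ h
    ⟨refl h.left, refl hu⟩).2
  rintro a ⟨ha, ha'⟩ b hab hb
  exact ⟨ha.step hab hb, ha'.step hab (hT _ (ha.step hab hb))⟩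

lemma map (φ : G ≃g G) (h : LinkedOff G T u v) : LinkedOff G (φ '' T) (φ u) (φ v) := by
  obtain ⟨p, hp⟩ := h
  refine ⟨p.map φ.toHom, fun z hz => ?_⟩
  rw [SimpleGraph.Walk.support_map, List.mem_map] at hz
  obtain ⟨y, hy, rfl⟩ := hz
  rintro ⟨x, hx, hxy⟩
  exact hp y hy (φ.injective hxy ▸ hx)

end LinkedOff

lemma linkedOff_of_connected {V : Type u} {G : SimpleGraph V} {X : Set V}
    (h : (G.induce X).Connected) {a b : V} (ha : a ∈ X) (hb : b ∈ X) : LinkedOff G Xᶜ a b := by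
  have key : ∀ c d : X, (G.induce X).Walk c d → LinkedOff G Xᶜ c d := by
    intro c d p
    induction p with
    | nil => exact LinkedOff.refl (T := Xᶜ) fun hc => hc (Subtype.prop _)
    | cons h _ ih => exact (LinkedOff.edge (T := Xᶜ) h (fun hc => hc (Subtype.prop _)) ih.left).trans ih
  obtain ⟨p⟩ := h.preconnected ⟨a, ha⟩ ⟨b, hb⟩
  exact key _ _ p

lemma connected_induce {V : Type u} {G : SimpleGraph V} {X : Set V} (hX : X.Nonempty)
    (h : ∀ a ∈ X, ∀ b ∈ X, LinkedOff G Xᶜ a b) : (G.induce X).Connected := by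
  obtain ⟨x, hx⟩ := hX
  have : Nonempty X := ⟨⟨x, hx⟩⟩
  refine ⟨fun a b => ?_⟩
  obtain ⟨p, hp⟩ := h a a.2 b b.2
  exact ⟨p.induce X fun z hz => not_not.1 (hp z hz)⟩

/-- The component of `u` in `G` minus `T` contains a ray. -/
def IsBig {V : Type u} (G : SimpleGraph V) (T : Set V) (u : V) : Prop :=
  ∃ r : ℕ → V, IsRay G r ∧ ∀ n, LinkedOff G T u (r n)

/-- `T` is a finite set separating two rays. -/
def EndSep {V : Type u} (G : SimpleGraph V) (T : Set V) : Prop :=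
  T.Finite ∧ ∃ u v, IsBig G T u ∧ IsBig G T v ∧ ¬ LinkedOff G T u v

/-- `T` is an end separator of minimum size. -/
def MinSep {V : Type u} (G : SimpleGraph V) (T : Set V) : Prop :=
  EndSep G T ∧ ∀ T', EndSep G T' → T.ncard ≤ T'.ncard

/-- `T` meets every component of `G` minus `S` that contains a ray. -/
def Crosses {V : Type u} (G : SimpleGraph V) (T S : Set V) : Prop :=
  ∀ u, IsBig G S u → ∃ t ∈ T, LinkedOff G S u t

/-- The minimum end separators crossing `S`. -/
def crossSet {V : Type u} (G : SimpleGraph V) (S : Set V) : Set (Set V) :=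
  {T | MinSep G T ∧ Crosses G T S}

/-- A minimum end separator crossed by as few minimum end separators as possible. -/
def OptSep {V : Type u} (G : SimpleGraph V) (S : Set V) : Prop :=
  MinSep G S ∧ ∀ S', MinSep G S' → (crossSet G S).ncard ≤ (crossSet G S').ncard

section Separators

variable {V : Type u} {G : SimpleGraph V} {S S' T T' A B A' B' : Set V} {u v w : V}

lemma IsBig.notMem (h : IsBig G T u) : u ∉ T := by
  obtain ⟨r, -, hr⟩ := h
  exact (hr 0).left

lemma IsBig.of_linked (h : IsBig G T u) (huv : LinkedOff G T u v) : IsBig G T v := by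
  obtain ⟨r, h1, hr⟩ := h
  exact ⟨r, h1, fun n => huv.symm.trans (hr n)⟩

lemma IsBig.mono (hT : T' ⊆ T) (h : IsBig G T u) : IsBig G T' u := by
  obtain ⟨r, h1, hr⟩ := h
  exact ⟨r, h1, fun n => (hr n).mono hT⟩

lemma IsBig.of_avoids (h : IsBig G T u) (hT : ∀ w, LinkedOff G T u w → w ∉ T') :
    IsBig G T' u := by
  obtain ⟨r, h1, hr⟩ := h
  exact ⟨r, h1, fun n => (hr n).of_avoids hT⟩

lemma IsRay.map (φ : G ≃g G) {r : ℕ → V} (h : IsRay G r) : IsRay G (fun n => φ (r n)) :=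
  ⟨φ.injective.comp h.1, fun n => φ.map_adj_iff.2 (h.2 n)⟩

lemma IsBig.map (φ : G ≃g G) (h : IsBig G T u) : IsBig G (φ '' T) (φ u) := by
  obtain ⟨r, h1, hr⟩ := h
  exact ⟨_, h1.map φ, fun n => (hr n).map φ⟩

lemma image_symm_image (φ : G ≃g G) (T : Set V) : φ.symm '' (φ '' T) = T := by
  ext x; simp

lemma EndSep.map (φ : G ≃g G) (h : EndSep G T) : EndSep G (φ '' T) := by
  obtain ⟨hf, u, v, hu, hv, huv⟩ := h
  refine ⟨hf.image _, φ u, φ v, hu.map φ, hv.map φ, fun h => huv ?_⟩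
  have := h.map φ.symm
  rwa [image_symm_image, φ.symm_apply_apply, φ.symm_apply_apply] at this

lemma MinSep.map (φ : G ≃g G) (h : MinSep G T) : MinSep G (φ '' T) :=
  ⟨h.1.map φ, fun T' hT' => by
    rw [Set.ncard_image_of_injective _ φ.injective]; exact h.2 T' hT'⟩

lemma Crosses.map (φ : G ≃g G) (h : Crosses G T S) : Crosses G (φ '' T) (φ '' S) := by
  intro u hu
  have h1 := hu.map φ.symm
  rw [image_symm_image] at h1
  obtain ⟨t, ht, h2⟩ := h _ h1
  refine ⟨φ t, ⟨t, ht, rfl⟩, ?_⟩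
  simpa using h2.map φ

lemma MinSep.exists_not_linked (h : MinSep G T) (u : V) :
    ∃ v, IsBig G T v ∧ ¬ LinkedOff G T u v := by
  obtain ⟨⟨-, v, w, hv, hw, hvw⟩, -⟩ := h
  by_cases h1 : LinkedOff G T u v
  · exact ⟨w, hw, fun h2 => hvw (h1.symm.trans h2)⟩
  · exact ⟨v, hv, h1⟩

/-- A component containing a ray is attached to every vertex of a minimum separator. -/
lemma MinSep.exists_adj (h : MinSep G T) (hu : IsBig G T u) {t : V} (ht : t ∈ T) :
    ∃ w, LinkedOff G T u w ∧ G.Adj w t := by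
  by_contra! hno
  obtain ⟨v, hv, huv⟩ := h.exists_not_linked u
  have hsub : T \ {t} ⊆ T := sdiff_subset
  have key : EndSep G (T \ {t}) := by
    refine ⟨h.1.1.subset hsub, u, v, hu.mono hsub, hv.mono hsub, fun hl => huv ?_⟩
    refine LinkedOff.mem_of_closed (X := {w | LinkedOff G T u w}) ?_ hl (.refl hu.notMem)
    intro a ha b hab hb
    refine LinkedOff.step ha hab fun hbT => hb ⟨hbT, ?_⟩
    rintro rfl
    exact hno a ha hab
  have h1 := h.2 _ key
  have h2 := Set.ncard_sdiff_singleton_lt_of_mem ht h.1.1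
  omega

lemma MinSep.linked_of_not_crosses (hS : MinSep G S) (h : ¬ Crosses G T S) {s t : V}
    (hs : s ∈ S) (ht : t ∈ S) (hsT : s ∉ T) (htT : t ∉ T) : LinkedOff G T s t := by
  unfold Crosses at h
  push Not at h
  obtain ⟨u, hu, hno⟩ := h
  have hav : ∀ w, LinkedOff G S u w → w ∉ T := fun w hw hwT => hno w hwT hw
  obtain ⟨a, ha, has⟩ := hS.exists_adj hu hs
  obtain ⟨b, hb, hbt⟩ := hS.exists_adj hu ht
  exact ((ha.of_avoids hav).step has hsT).symm.trans ((hb.of_avoids hav).step hbt htT)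

lemma Crosses.symm (hS : MinSep G S) (hT : MinSep G T) (h : Crosses G S T) :
    Crosses G T S := by
  by_contra hno
  obtain ⟨⟨-, v, w, hv, hw, hvw⟩, -⟩ := hT
  obtain ⟨s, hs, hvs⟩ := h v hv
  obtain ⟨t, ht, hwt⟩ := h w hw
  exact hvw ((hvs.trans (hS.linked_of_not_crosses hno hs ht hvs.right hwt.right)).trans hwt.symm)

lemma finite_minSep_aux (u v : V) (k : ℕ) : ∀ F : Set V,
    {T | MinSep G T ∧ IsBig G T u ∧ IsBig G T v ∧ ¬ LinkedOff G T u v ∧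
      F ⊆ T ∧ (T \ F).ncard = k}.Finite := by
  induction k with
  | zero =>
    intro F
    refine (Set.finite_singleton F).subset ?_
    rintro T ⟨hT, -, -, -, hF, h0⟩
    rw [Set.ncard_eq_zero (hT.1.1.subset sdiff_subset), sdiff_eq_empty] at h0
    exact h0.antisymm hF
  | succ k ih =>
    intro F
    rcases Set.eq_empty_or_nonempty {T | MinSep G T ∧ IsBig G T u ∧ IsBig G T v ∧
      ¬ LinkedOff G T u v ∧ F ⊆ T ∧ (T \ F).ncard = k + 1} with he | ⟨T₀, hT₀, hu, hv, -, hF, hk⟩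
    · rw [he]; exact Set.finite_empty
    obtain ⟨t, ht, htF⟩ : (T₀ \ F).Nonempty := by
      rw [Set.nonempty_iff_ne_empty]
      intro h
      simp [h] at hk
    obtain ⟨a, ha, hat⟩ := hT₀.exists_adj hu ht
    obtain ⟨b, hb, hbt⟩ := hT₀.exists_adj hv ht
    obtain ⟨p, hp⟩ : LinkedOff G F u v :=
      ((ha.mono hF).step hat htF).trans ((hb.mono hF).step hbt htF).symm
    refine ((List.finite_toSet p.support).biUnion fun z _ => ih (insert z F)).subset ?_
    rintro T ⟨hT, hu, hv, huv, hFT, hcard⟩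
    obtain ⟨z, hz, hzT⟩ : ∃ z ∈ p.support, z ∈ T := by
      by_contra! hno
      exact huv ⟨p, hno⟩
    refine Set.mem_biUnion hz ⟨hT, hu, hv, huv, Set.insert_subset hzT hFT, ?_⟩
    have h1 : T \ insert z F = (T \ F) \ {z} := by
      ext y; simp only [mem_sdiff, mem_insert_iff, mem_singleton_iff]; tauto
    rw [h1, Set.ncard_sdiff_singleton_of_mem (show z ∈ T \ F from ⟨hzT, hp z hz⟩), hcard]
    rfl

/-- Only finitely many minimum separators separate two given vertices. -/
lemma finite_minSep (u v : V) :
    {T | MinSep G T ∧ IsBig G T u ∧ IsBig G T v ∧ ¬ LinkedOff G T u v}.Finite := by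
  rcases Set.eq_empty_or_nonempty
    {T | MinSep G T ∧ IsBig G T u ∧ IsBig G T v ∧ ¬ LinkedOff G T u v} with he | ⟨T₀, h₀, -⟩
  · rw [he]; exact Set.finite_empty
  refine (finite_minSep_aux (G := G) u v T₀.ncard ∅).subset ?_
  rintro T ⟨hT, h⟩
  refine ⟨hT, h.1, h.2.1, h.2.2, Set.empty_subset _, ?_⟩
  rw [sdiff_empty]
  exact le_antisymm (hT.2 _ h₀.1) (h₀.2 _ hT.1)

lemma finite_crossSet (hS : MinSep G S) : (crossSet G S).Finite := by
  refine (hS.1.1.biUnion fun u _ => hS.1.1.biUnion fun v _ =>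
    finite_minSep (G := G) u v).subset ?_
  rintro T ⟨hT, hTS⟩
  have hcr := hTS.symm hT hS
  obtain ⟨-, v, w, hv, hw, hvw⟩ := hT.1
  obtain ⟨s, hs, hvs⟩ := hcr v hv
  obtain ⟨t, ht, hwt⟩ := hcr w hw
  exact Set.mem_biUnion hs (Set.mem_biUnion ht ⟨hT, hv.of_linked hvs, hw.of_linked hwt,
    fun h => hvw ((hvs.trans h).trans hwt.symm)⟩)

lemma OptSep.map (φ : G ≃g G) (h : OptSep G S) : OptSep G (φ '' S) := by
  refine ⟨h.1.map φ, fun S' hS' => le_trans ?_ (h.2 S' hS')⟩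
  refine Set.ncard_le_ncard_of_injOn (fun T => φ.symm '' T) ?_ ?_ (finite_crossSet h.1)
  · rintro T ⟨h1, h2⟩
    have := h2.map φ.symm
    rw [image_symm_image] at this
    exact ⟨h1.map φ.symm, this⟩
  · exact (Set.image_injective.2 φ.symm.injective).injOn

/-- `A` and `B` are unions of components of `G` minus `S`, and cover all of it. -/
structure SidePair (G : SimpleGraph V) (S A B : Set V) : Prop where
  cover : ∀ v, v ∈ A ∨ v ∈ S ∨ v ∈ B
  left_sep : ∀ v ∈ A, v ∉ S
  right_sep : ∀ v ∈ B, v ∉ S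
  left_right : ∀ v ∈ A, v ∉ B
  no_edge : ∀ a ∈ A, ∀ b ∈ B, ¬ G.Adj a b

lemma SidePair.symm (h : SidePair G S A B) : SidePair G S B A where
  cover v := by have := h.cover v; tauto
  left_sep := h.right_sep
  right_sep := h.left_sep
  left_right v hB hA := h.left_right v hA hB
  no_edge a ha b hb hab := h.no_edge b hb a ha hab.symm

lemma SidePair.linked_mem (h : SidePair G S A B) (huv : LinkedOff G S u v) (hu : u ∈ A) :
    v ∈ A := by
  refine huv.mem_of_closed (fun a ha b hab hb => ?_) hu
  have h1 := h.cover b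
  have h2 := h.no_edge a ha b
  tauto

lemma sidePair_component :
    SidePair G S {w | LinkedOff G S u w} {w | w ∉ S ∧ ¬ LinkedOff G S u w} where
  cover v := by simp only [mem_ofPred_eq]; tauto
  left_sep v hv := hv.right
  right_sep v hv := hv.1
  left_right v hv hv' := hv'.2 hv
  no_edge a ha b hb hab := hb.2 (LinkedOff.step ha hab hb.1)

lemma IsRay.shift {r : ℕ → V} (h : IsRay G r) (N : ℕ) : IsRay G (fun n => r (N + n)) :=
  ⟨fun _ _ hab => by simpa using h.1 hab, fun n => h.2 (N + n)⟩

lemma IsRay.eventually_notMem {r : ℕ → V} (h : IsRay G r) (hT : T.Finite) :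
    ∃ N, ∀ n, r (N + n) ∉ T := by
  have h1 : (r ⁻¹' T).Finite := hT.preimage h.1.injOn
  obtain ⟨N, hN⟩ := h1.bddAbove
  refine ⟨N + 1, fun n hn => ?_⟩
  have := hN hn
  omega

lemma IsRay.linkedOff {r : ℕ → V} (h : IsRay G r) (hT : ∀ n, r n ∉ T) (n : ℕ) :
    LinkedOff G T (r 0) (r n) := by
  induction n with
  | zero => exact .refl (hT 0)
  | succ n ih => exact ih.step (h.2 n) (hT _)

lemma SidePair.exists_isBig (h : SidePair G S A B) (hA : ContainsEnd G A) :
    ∃ u ∈ A, IsBig G S u := by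
  obtain ⟨r, hr, hrA⟩ := hA
  exact ⟨r 0, hrA 0, r, hr, fun n => hr.linkedOff (fun n => h.left_sep _ (hrA n)) n⟩

lemma SidePair.endSep (h : SidePair G S A B) (hS : S.Finite) (hA : ContainsEnd G A)
    (hB : ContainsEnd G B) : EndSep G S := by
  obtain ⟨u, huA, hu⟩ := h.exists_isBig hA
  obtain ⟨v, hvB, hv⟩ := h.symm.exists_isBig hB
  exact ⟨hS, u, v, hu, hv, fun huv => h.left_right v (h.linked_mem huv huA) hvB⟩

lemma SidePair.containsEnd_inter (h : SidePair G S A B) (hS : S.Finite) {X : Set V}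
    (hX : ContainsEnd G X) : ContainsEnd G (X ∩ A) ∨ ContainsEnd G (X ∩ B) := by
  obtain ⟨r, hr, hrX⟩ := hX
  obtain ⟨N, hN⟩ := hr.eventually_notMem hS
  have hl := (hr.shift N).linkedOff hN
  rcases h.cover (r (N + 0)) with h0 | h0 | h0
  · exact Or.inl ⟨_, hr.shift N, fun n => ⟨hrX _, h.linked_mem (hl n) h0⟩⟩
  · exact absurd h0 (hN 0)
  · exact Or.inr ⟨_, hr.shift N, fun n => ⟨hrX _, h.symm.linked_mem (hl n) h0⟩⟩

/-- The separator of the corner `A ∩ A'`. -/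
def cornerSep (S S' A A' : Set V) : Set V :=
  {v | (v ∈ S ∧ v ∈ S') ∨ (v ∈ S ∧ v ∈ A') ∨ (v ∈ A ∧ v ∈ S')}

lemma SidePair.corner (h : SidePair G S A B) (h' : SidePair G S' A' B') :
    SidePair G (cornerSep S S' A A') (A ∩ A') (B ∪ B') where
  cover v := by
    have h1 := h.cover v
    have h2 := h'.cover v
    simp only [cornerSep, mem_ofPred_eq, mem_inter_iff, mem_union]
    tauto
  left_sep v hv := by
    have h1 := h.left_sep v hv.1
    have h2 := h'.left_sep v hv.2
    simp only [cornerSep, mem_ofPred_eq]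
    tauto
  right_sep v hv := by
    have h1 := h.right_sep v
    have h2 := h'.right_sep v
    have h3 := h.symm.left_right v
    have h4 := h'.symm.left_right v
    simp only [mem_union] at hv
    simp only [cornerSep, mem_ofPred_eq]
    tauto
  left_right v hv hv' := by
    have h3 := h.left_right v hv.1
    have h4 := h'.left_right v hv.2
    exact hv'.elim h3 h4
  no_edge a ha b hb := by
    have h3 := h.no_edge a ha.1 b
    have h4 := h'.no_edge a ha.2 b
    exact hb.elim h3 h4

lemma SidePair.ncard_corner (h : SidePair G S A B) (h' : SidePair G S' A' B')
    (hS : S.Finite) (hS' : S'.Finite) :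
    (cornerSep S S' A A').ncard + (cornerSep S S' B B').ncard ≤ S.ncard + S'.ncard := by
  have hU : cornerSep S S' A A' ∪ cornerSep S S' B B' ⊆ S ∪ S' := by
    intro v
    simp only [cornerSep, mem_ofPred_eq, mem_union]
    tauto
  have hI : cornerSep S S' A A' ∩ cornerSep S S' B B' ⊆ S ∩ S' := by
    intro v
    have h1 := h.left_sep v
    have h2 := h.right_sep v
    have h3 := h.left_right v
    have h1' := h'.left_sep v
    have h2' := h'.right_sep v
    have h3' := h'.left_right v
    simp only [cornerSep, mem_ofPred_eq, mem_inter_iff]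
    tauto
  have hfin := hS.union hS'
  have hf := hfin.subset hU
  rw [← Set.ncard_union_add_ncard_inter _ _ (hf.subset subset_union_left)
    (hf.subset subset_union_right), ← Set.ncard_union_add_ncard_inter _ _ hS hS']
  exact add_le_add (Set.ncard_le_ncard hU hfin)
    (Set.ncard_le_ncard hI (hS.subset inter_subset_left))

lemma MinSep.subset_side (hT : MinSep G T) (hno : ¬ Crosses G S T)
    (h : SidePair G S A B) : (∀ t ∈ T, t ∉ B) ∨ (∀ t ∈ T, t ∉ A) := by
  by_contra! hc
  obtain ⟨⟨s, hs, hsB⟩, t, ht, htA⟩ := hc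
  have := hT.linked_of_not_crosses hno hs ht (h.right_sep s hsB) (h.left_sep t htA)
  exact h.left_right t htA (h.symm.linked_mem this hsB)

lemma SidePair.not_crosses (h : SidePair G S A B) (hA : ContainsEnd G A)
    (hT : ∀ t ∈ T, t ∉ A) : ¬ Crosses G T S := by
  intro hc
  obtain ⟨u, huA, hu⟩ := h.exists_isBig hA
  obtain ⟨t, ht, hut⟩ := hc u hu
  exact hT t ht (h.linked_mem hut huA)

lemma SidePair.not_crosses_corner (h : SidePair G S A B) (h' : SidePair G S' A' B')
    (hA : ContainsEnd G (A ∩ A')) (hB : ContainsEnd G (B ∩ B'))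
    (hT : (∀ t ∈ T, t ∉ B) ∨ (∀ t ∈ T, t ∉ A))
    (hT' : (∀ t ∈ T, t ∉ B') ∨ (∀ t ∈ T, t ∉ A')) :
    ¬ Crosses G T (cornerSep S S' A A') := by
  have hc := h.corner h'
  by_cases hd : ∀ t ∈ T, t ∉ A ∩ A'
  · exact hc.not_crosses hA hd
  · push Not at hd
    obtain ⟨t, ht, htA, htA'⟩ := hd
    refine hc.symm.not_crosses ?_ ?_
    · obtain ⟨r, hr, hrB⟩ := hB
      exact ⟨r, hr, fun n => Or.inl (hrB n).1⟩
    · rintro s hs (hsB | hsB)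
      · rcases hT with h1 | h1
        exacts [h1 s hs hsB, h1 t ht htA]
      · rcases hT' with h1 | h1
        exacts [h1 s hs hsB, h1 t ht htA']

lemma OptSep.not_crosses_of_corner (hS : OptSep G S) (hS' : OptSep G S')
    (h : SidePair G S A B) (h' : SidePair G S' A' B')
    (hA : ContainsEnd G (A ∩ A')) (hB : ContainsEnd G (B ∩ B')) : ¬ Crosses G S S' := by
  intro hcr
  have hf := hS.1.1.1
  have hf' := hS'.1.1.1
  have hsub : ∀ X Y : Set V, cornerSep S S' X Y ⊆ S ∪ S' := by
    intro X Y v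
    simp only [cornerSep, mem_ofPred_eq, mem_union]
    tauto
  have e1 : EndSep G (cornerSep S S' A A') := (h.corner h').endSep
    ((hf.union hf').subset (hsub _ _)) hA
    (by obtain ⟨r, hr, hrB⟩ := hB; exact ⟨r, hr, fun n => Or.inl (hrB n).1⟩)
  have e2 : EndSep G (cornerSep S S' B B') := (h.symm.corner h'.symm).endSep
    ((hf.union hf').subset (hsub _ _)) hB
    (by obtain ⟨r, hr, hrB⟩ := hA; exact ⟨r, hr, fun n => Or.inl (hrB n).1⟩)
  have hle := h.ncard_corner h' hf hf'
  have l1 := hS.1.2 _ e1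
  have l2 := hS.1.2 _ e2
  have l3 := hS.1.2 _ hS'.1.1
  have l4 := hS'.1.2 _ hS.1.1
  have m1 : MinSep G (cornerSep S S' A A') :=
    ⟨e1, fun T hT => by have := hS.1.2 _ hT; omega⟩
  have m2 : MinSep G (cornerSep S S' B B') :=
    ⟨e2, fun T hT => by have := hS.1.2 _ hT; omega⟩
  have o1 := hS.2 _ m1
  have o2 := hS'.2 _ m2
  have fS := finite_crossSet hS.1
  have fS' := finite_crossSet hS'.1
  have f1 := finite_crossSet m1
  have f2 := finite_crossSet m2
  have nB : ∀ T, MinSep G T → ∀ X Z Y : Set V, MinSep G X → SidePair G X Z Y →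
      ¬ Crosses G T X → (∀ t ∈ T, t ∉ Y) ∨ (∀ t ∈ T, t ∉ Z) := fun T hT X Z Y hX hs hno =>
    hT.subset_side (fun hc => hno (hc.symm hX hT)) hs
  have hI : crossSet G (cornerSep S S' A A') ∩ crossSet G (cornerSep S S' B B') ⊆
      crossSet G S ∩ crossSet G S' := by
    rintro T ⟨⟨hT, c1⟩, -, c2⟩
    refine ⟨⟨hT, ?_⟩, hT, ?_⟩
    · by_contra hno
      rcases nB T hT S A B hS.1 h hno with hd | hd
      · exact (h.symm.corner h'.symm).not_crosses hB (fun t ht ht' => hd t ht ht'.1) c2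
      · exact (h.corner h').not_crosses hA (fun t ht ht' => hd t ht ht'.1) c1
    · by_contra hno
      rcases nB T hT S' A' B' hS'.1 h' hno with hd | hd
      · exact (h.symm.corner h'.symm).not_crosses hB (fun t ht ht' => hd t ht ht'.2) c2
      · exact (h.corner h').not_crosses hA (fun t ht ht' => hd t ht ht'.2) c1
  have hU : crossSet G (cornerSep S S' A A') ∪ crossSet G (cornerSep S S' B B') ⊂
      crossSet G S ∪ crossSet G S' := by
    refine ⟨?_, fun hc => ?_⟩
    · intro T hT
      by_contra hno
      have hTm : MinSep G T := hT.elim (fun h => h.1) (fun h => h.1)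
      have n1 : ¬ Crosses G T S := fun hc => hno (Or.inl ⟨hTm, hc⟩)
      have n2 : ¬ Crosses G T S' := fun hc => hno (Or.inr ⟨hTm, hc⟩)
      have s1 := nB T hTm S A B hS.1 h n1
      have s2 := nB T hTm S' A' B' hS'.1 h' n2
      rcases hT with hT | hT
      · exact h.not_crosses_corner h' hA hB s1 s2 hT.2
      · exact h.symm.not_crosses_corner h'.symm hB hA s1.symm s2.symm hT.2
    · rcases hc (Or.inr ⟨hS.1, hcr⟩) with hc | hc
      · exact (h.corner h').not_crosses hA (fun t ht ht' => h.left_sep t ht'.1 ht) hc.2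
      · exact (h.symm.corner h'.symm).not_crosses hB
          (fun t ht ht' => h.right_sep t ht'.1 ht) hc.2
  have k1 := Set.ncard_union_add_ncard_inter _ _ f1 f2
  have k2 := Set.ncard_union_add_ncard_inter _ _ fS fS'
  have k3 := Set.ncard_lt_ncard hU (fS.union fS')
  have k4 := Set.ncard_le_ncard hI (fS.subset inter_subset_left)
  omega

lemma MinSep.exists_sidePair (h : MinSep G S) :
    ∃ A B, SidePair G S A B ∧ ContainsEnd G A ∧ ContainsEnd G B := by
  obtain ⟨⟨-, u, v, hu, hv, huv⟩, -⟩ := h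
  refine ⟨_, _, sidePair_component (u := u), ?_, ?_⟩
  · obtain ⟨r, hr, hl⟩ := hu
    exact ⟨r, hr, hl⟩
  · obtain ⟨r, hr, hl⟩ := hv
    exact ⟨r, hr, fun n => ⟨(hl n).right, fun hc => huv (hc.trans (hl n).symm)⟩⟩

/-- Optimal separators are pairwise nested. -/
lemma OptSep.not_crosses (hS : OptSep G S) (hS' : OptSep G S') : ¬ Crosses G S S' := by
  obtain ⟨A, B, h, hA, hB⟩ := hS.1.exists_sidePair
  obtain ⟨A', B', h', hA', hB'⟩ := hS'.1.exists_sidePair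
  have a1 := h'.containsEnd_inter hS'.1.1.1 hA
  have b1 := h'.containsEnd_inter hS'.1.1.1 hB
  have a2 := h.containsEnd_inter hS.1.1.1 hA'
  have b2 := h.containsEnd_inter hS.1.1.1 hB'
  rw [inter_comm A' A, inter_comm A' B] at a2
  rw [inter_comm B' A, inter_comm B' B] at b2
  by_cases c1 : ContainsEnd G (A ∩ A') ∧ ContainsEnd G (B ∩ B')
  · exact hS.not_crosses_of_corner hS' h h' c1.1 c1.2
  · exact hS.not_crosses_of_corner hS' h h'.symm (by tauto) (by tauto)

lemma OptSep.linked (hS : OptSep G S) (hS' : OptSep G S') {s t : V} (hs : s ∈ S') (ht : t ∈ S')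
    (hsS : s ∉ S) (htS : t ∉ S) : LinkedOff G S s t :=
  hS'.1.linked_of_not_crosses (hS.not_crosses hS') hs ht hsS htS

lemma exists_optSep (h : MoreThanOneEnd G) : ∃ S, OptSep G S := by
  obtain ⟨r, r', hr, hr', hne⟩ := h
  unfold RayEquiv at hne
  push Not at hne
  obtain ⟨S, hS⟩ := hne
  obtain ⟨N, hN⟩ := hr.eventually_notMem S.finite_toSet
  obtain ⟨N', hN'⟩ := hr'.eventually_notMem S.finite_toSet
  have hl := (hr.shift N).linkedOff hN
  have hl' := (hr'.shift N').linkedOff hN'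
  have hend : EndSep G (S : Set V) := by
    refine ⟨S.finite_toSet, r (N + 0), r' (N' + 0), ⟨_, hr.shift N, hl⟩, ⟨_, hr'.shift N', hl'⟩,
      fun hc => ?_⟩
    refine hS {w | LinkedOff G S (r (N + 0)) w} ⟨⟨_, hl 0⟩, fun w hw => hw.right, ?_, ?_⟩ ?_ ?_
    · refine connected_induce ⟨_, hl 0⟩ fun a ha b hb => ?_
      exact (ha.symm.trans hb).of_avoids fun w hw hw' => hw' (ha.trans hw)
    · intro C' hC hC' hconn
      refine (Subset.antisymm hC fun w hw => ?_).symm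
      exact (linkedOff_of_connected hconn (hC (hl 0)) hw).mono fun z hz hz' => hC' hz' hz
    · refine ⟨N, fun n hn => ?_⟩
      obtain ⟨m, rfl⟩ := Nat.exists_eq_add_of_le hn
      exact hl m
    · refine ⟨N', fun n hn => ?_⟩
      obtain ⟨m, rfl⟩ := Nat.exists_eq_add_of_le hn
      exact hc.trans (hl' m)
  obtain ⟨T, hT, hTmin⟩ := WellFounded.has_min (measure (Set.ncard (α := V))).wf
    {T | EndSep G T} ⟨_, hend⟩
  have hTm : MinSep G T := ⟨hT, fun T' hT' => not_lt.1 (hTmin T' hT')⟩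
  obtain ⟨U, hU, hUmin⟩ := WellFounded.has_min (measure fun S => (crossSet G S).ncard).wf
    {T | MinSep G T} ⟨_, hTm⟩
  exact ⟨U, hU, fun T' hT' => not_lt.1 (hUmin T' hT')⟩

end Separators

/-- The optimal separators `T` such that `u` and `v` lie in different components of `G` minus `T`,
each containing a ray. -/
def sepSet {V : Type u} (G : SimpleGraph V) (u v : V) : Set (Set V) :=
  {T | OptSep G T ∧ IsBig G T u ∧ IsBig G T v ∧ ¬ LinkedOff G T u v}

lemma finite_sepSet {V : Type u} {G : SimpleGraph V} (u v : V) : (sepSet G u v).Finite :=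
  (finite_minSep (G := G) u v).subset fun _ hT => ⟨hT.1.1, hT.2⟩

lemma not_linkedOff_map {V : Type u} {G : SimpleGraph V} {T : Set V} {u v : V} (φ : G ≃g G)
    (h : ¬ LinkedOff G T u v) : ¬ LinkedOff G (φ '' T) (φ u) (φ v) := by
  intro hc
  have := hc.map φ.symm
  rw [image_symm_image, φ.symm_apply_apply, φ.symm_apply_apply] at this
  exact h this

lemma ncard_sepSet_le {V : Type u} {G : SimpleGraph V} (φ : G ≃g G) (u v : V) :
    (sepSet G u v).ncard ≤ (sepSet G (φ u) (φ v)).ncard := by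
  refine Set.ncard_le_ncard_of_injOn (fun T => φ '' T) ?_ ?_ (finite_sepSet _ _)
  · rintro T ⟨h1, h2, h3, h4⟩
    exact ⟨h1.map φ, h2.map φ, h3.map φ, not_linkedOff_map φ h4⟩
  · exact (Set.image_injective.2 φ.injective).injOn

section Geodesic

variable {V : Type u} {G : SimpleGraph V}

/-- `q 0, …, q k` is a geodesic of `G`. -/
def IsGeodesic (G : SimpleGraph V) (k : ℕ) (q : ℕ → V) : Prop :=
  (∀ i < k, G.Adj (q i) (q (i + 1))) ∧ k ≤ G.dist (q 0) (q k)

lemma exists_isGeodesic (hG : G.Connected) (x y : V) :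
    ∃ q, q 0 = x ∧ q (G.dist x y) = y ∧ IsGeodesic G (G.dist x y) q := by
  obtain ⟨p, hp⟩ := hG.exists_walk_length_eq_dist x y
  refine ⟨p.getVert, p.getVert_zero, ?_, fun i hi => p.adj_getVert_succ (hp ▸ hi), ?_⟩
  · rw [← hp, p.getVert_length]
  · rw [← hp, p.getVert_length, p.getVert_zero, hp]

lemma IsGeodesic.dist_le (hG : G.Connected) {k : ℕ} {q : ℕ → V} (h : IsGeodesic G k q)
    (i j : ℕ) (hj : i + j ≤ k) : G.dist (q i) (q (i + j)) ≤ j := by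
  induction j with
  | zero => simp
  | succ j ih =>
    have h1 := ih (by omega)
    have h2 := hG.dist_triangle (u := q i) (v := q (i + j)) (w := q (i + j + 1))
    have h3 := SimpleGraph.dist_eq_one_iff_adj.2 (h.1 (i + j) (by omega))
    rw [← add_assoc]
    omega

lemma IsGeodesic.dist_eq (hG : G.Connected) {k : ℕ} {q : ℕ → V} (h : IsGeodesic G k q)
    (i j : ℕ) (hj : i + j ≤ k) : G.dist (q i) (q (i + j)) = j := by
  have h1 := h.dist_le hG i j hj
  have h2 := h.dist_le hG 0 i (by omega)
  have h3 := h.dist_le hG (i + j) (k - (i + j)) (by omega)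
  rw [show i + j + (k - (i + j)) = k by omega] at h3
  rw [zero_add] at h2
  have h4 := hG.dist_triangle (u := q 0) (v := q i) (w := q (i + j))
  have h5 := hG.dist_triangle (u := q 0) (v := q (i + j)) (w := q k)
  have h6 := h.2
  omega

lemma IsGeodesic.injOn (hG : G.Connected) {k : ℕ} {q : ℕ → V} (h : IsGeodesic G k q)
    {i j : ℕ} (hi : i ≤ k) (hj : j ≤ k) (hij : q i = q j) : i = j := by
  wlog hle : i ≤ j generalizing i j
  · exact (this hj hi hij.symm (by omega)).symm
  obtain ⟨m, rfl⟩ := Nat.exists_eq_add_of_le hle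
  have := h.dist_eq hG i m hj
  rw [← hij, SimpleGraph.dist_self] at this
  omega

lemma IsGeodesic.of_adj (hG : G.Connected) {k : ℕ} {q : ℕ → V} (h : IsGeodesic G k q)
    {i j : ℕ} (hi : i ≤ k) (hj : j ≤ k) (hij : G.Adj (q i) (q j)) : i + 1 = j ∨ j + 1 = i := by
  wlog hle : i ≤ j generalizing i j
  · exact (this hj hi hij.symm (by omega)).symm
  obtain ⟨m, rfl⟩ := Nat.exists_eq_add_of_le hle
  have := h.dist_eq hG i m hj
  rw [SimpleGraph.dist_eq_one_iff_adj.2 hij] at this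
  omega

end Geodesic

section Digraph

variable {V : Type u} {E : V → V → Prop}

lemma IsDigraph.adj_iff (hd : IsDigraph E) {x y : V} : (UG E).Adj x y ↔ E x y ∨ E y x := by
  rw [UG, SimpleGraph.fromRel_adj]
  refine ⟨fun h => h.2, fun h => ⟨?_, h⟩⟩
  rintro rfl
  exact hd.1 x (h.elim id id)

lemma IsDigraph.rev_iff (hd : IsDigraph E) {x y : V} (h : (UG E).Adj x y) :
    E y x ↔ ¬ E x y := by
  have h1 := hd.adj_iff.1 h
  have h2 := hd.2 x y
  tauto

/-- The automorphism of the underlying graph induced by an automorphism of a digraph. -/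
def ugIso (ψ : E ≃r E) : UG E ≃g UG E where
  toEquiv := ψ.toEquiv
  map_rel_iff' := by
    intro a b
    simp [UG, SimpleGraph.fromRel_adj, ψ.map_rel_iff]

@[simp] lemma ugIso_apply (ψ : E ≃r E) (x : V) : ugIso ψ x = ψ x := rfl

lemma DigraphCHom.exists_path (hh : DigraphCHom E) {p q : ℕ → V} {k : ℕ}
    (hp : ∀ i ≤ k, ∀ j ≤ k, p i = p j → i = j) (hq : ∀ i ≤ k, ∀ j ≤ k, q i = q j → i = j)
    (hadj : ∀ i < k, (UG E).Adj (p i) (p (i + 1)))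
    (hE : ∀ i ≤ k, ∀ j ≤ k, (E (p i) (p j) ↔ E (q i) (q j))) :
    ∃ ψ : E ≃r E, ∀ i ≤ k, ψ (p i) = q i := by
  have ip : Function.Injective fun i : Fin (k + 1) => p i := fun i j hij =>
    Fin.ext (hp i (by omega) j (by omega) hij)
  have iq : Function.Injective fun i : Fin (k + 1) => q i := fun i j hij =>
    Fin.ext (hq i (by omega) j (by omega) hij)
  have hmem : ∀ i ≤ k, p i ∈ Set.range fun i : Fin (k + 1) => p i := fun i hi =>
    ⟨⟨i, by omega⟩, rfl⟩
  have hl : ∀ i ≤ k, LinkedOff (UG E) (Set.range fun i : Fin (k + 1) => p i)ᶜ (p 0) (p i) := by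
    intro i hi
    induction i with
    | zero => exact .refl (not_not.2 (hmem 0 hi))
    | succ i ih => exact (ih (by omega)).step (hadj i (by omega)) (not_not.2 (hmem _ hi))
  obtain ⟨ψ, h1, h2⟩ := hh _ _ (Set.finite_range _) (Set.finite_range _)
    (connected_induce ⟨_, hmem 0 (by omega)⟩ (by
      rintro _ ⟨i, rfl⟩ _ ⟨j, rfl⟩
      exact (hl i (by omega)).symm.trans (hl j (by omega))))
    ((Equiv.ofInjective _ ip).symm.trans (Equiv.ofInjective _ iq)) (by
      intro a b
      obtain ⟨i, rfl⟩ := (Equiv.ofInjective _ ip).surjective a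
      obtain ⟨j, rfl⟩ := (Equiv.ofInjective _ ip).surjective b
      simpa using hE i (by omega) j (by omega))
  refine ⟨⟨ψ, h1 _ _⟩, fun i hi => ?_⟩
  have h3 := h2 (Equiv.ofInjective _ ip ⟨i, by omega⟩)
  rw [Equiv.trans_apply, Equiv.symm_apply_apply] at h3
  exact h3

lemma DigraphCHom.exists_vertex (hd : IsDigraph E) (hh : DigraphCHom E) (x y : V) :
    ∃ ψ : E ≃r E, ψ x = y := by
  obtain ⟨ψ, h⟩ := hh.exists_path (p := fun _ => x) (q := fun _ => y) (k := 0)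
    (by intros; omega) (by intros; omega) (by intros; omega)
    (by intros; simp [hd.1])
  exact ⟨ψ, h 0 le_rfl⟩

lemma DigraphCHom.exists_edge (hd : IsDigraph E) (hh : DigraphCHom E) {x a y b : V}
    (hx : (UG E).Adj x a) (hy : (UG E).Adj y b) (h : E x a ↔ E y b) :
    ∃ ψ : E ≃r E, ψ x = y ∧ ψ a = b := by
  have r1 := hd.rev_iff hx
  have r2 := hd.rev_iff hy
  obtain ⟨ψ, h⟩ := hh.exists_path (p := fun i => if i = 0 then x else a)
    (q := fun i => if i = 0 then y else b) (k := 1)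
    (by intro i hi j hj; interval_cases i <;> interval_cases j <;> simp [hx.ne, hx.ne'])
    (by intro i hi j hj; interval_cases i <;> interval_cases j <;> simp [hy.ne, hy.ne'])
    (by intro i hi; interval_cases i; simpa using hx)
    (by intro i hi j hj; interval_cases i <;> interval_cases j <;> simp [hd.1, h, r1, r2])
  exact ⟨ψ, by simpa using h 0 (by omega), by simpa using h 1 le_rfl⟩

lemma DigraphCHom.exists_cherry (hd : IsDigraph E) (hh : DigraphCHom E) {x a b y c d : V}
    (hxa : (UG E).Adj x a) (hxb : (UG E).Adj x b) (hab : a ≠ b) (nab : ¬ (UG E).Adj a b)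
    (hyc : (UG E).Adj y c) (hyd : (UG E).Adj y d) (hcd : c ≠ d) (ncd : ¬ (UG E).Adj c d)
    (h : E x a ↔ E y c) (h' : E x b ↔ E y d) :
    ∃ ψ : E ≃r E, ψ x = y ∧ ψ a = c ∧ ψ b = d := by
  have r1 := hd.rev_iff hxa
  have r2 := hd.rev_iff hxb
  have r3 := hd.rev_iff hyc
  have r4 := hd.rev_iff hyd
  rw [hd.adj_iff, not_or] at nab ncd
  obtain ⟨ψ, h⟩ := hh.exists_path (p := fun i => if i = 0 then a else if i = 1 then x else b)
    (q := fun i => if i = 0 then c else if i = 1 then y else d) (k := 2)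
    (by intro i hi j hj; interval_cases i <;> interval_cases j <;>
          simp [hxa.ne, hxa.ne', hxb.ne, hxb.ne', hab, hab.symm])
    (by intro i hi j hj; interval_cases i <;> interval_cases j <;>
          simp [hyc.ne, hyc.ne', hyd.ne, hyd.ne', hcd, hcd.symm])
    (by intro i hi; interval_cases i; exacts [by simpa using hxa.symm, by simpa using hxb])
    (by intro i hi j hj; interval_cases i <;> interval_cases j <;>
          simp [hd.1, h, h', r1, r2, r3, r4, nab, ncd])
  exact ⟨ψ, by simpa using h 1 (by omega), by simpa using h 0 (by omega),
    by simpa using h 2 le_rfl⟩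

lemma DigraphCHom.exists_geodesic (hd : IsDigraph E) (hh : DigraphCHom E)
    (hG : (UG E).Connected) {k : ℕ} {q r : ℕ → V} (hq : IsGeodesic (UG E) k q)
    (hr : IsGeodesic (UG E) k r) (h : ∀ i < k, (E (q i) (q (i + 1)) ↔ E (r i) (r (i + 1)))) :
    ∃ ψ : E ≃r E, ∀ i ≤ k, ψ (q i) = r i := by
  refine hh.exists_path (fun i hi j hj => hq.injOn hG hi hj) (fun i hi j hj => hr.injOn hG hi hj)
    hq.1 fun i hi j hj => ?_
  by_cases hij : i + 1 = j ∨ j + 1 = i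
  · rcases hij with rfl | rfl
    · exact h i hj
    · rw [hd.rev_iff (hq.1 j hi), hd.rev_iff (hr.1 j hi), h j hi]
  · have h1 := mt (hq.of_adj hG hi hj) hij
    have h2 := mt (hr.of_adj hG hi hj) hij
    rw [hd.adj_iff, not_or] at h1 h2
    exact iff_of_false h1.1 h2.1

/-- Optimal separators separating the endpoints of an induced path of length two: their
number is bounded. -/
lemma exists_ncard_sepSet_le (hd : IsDigraph E) (hh : DigraphCHom E) :
    ∃ M, ∀ x a b, (UG E).Adj x a → (UG E).Adj x b → a ≠ b → ¬ (UG E).Adj a b →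
      (sepSet (UG E) a b).ncard ≤ M := by
  have key : ∀ s t : Prop, ∃ M, ∀ x a b, (UG E).Adj x a → (UG E).Adj x b → a ≠ b →
      ¬ (UG E).Adj a b → (E x a ↔ s) → (E x b ↔ t) → (sepSet (UG E) a b).ncard ≤ M := by
    intro s t
    by_cases hex : ∃ y c d, (UG E).Adj y c ∧ (UG E).Adj y d ∧ c ≠ d ∧ ¬ (UG E).Adj c d ∧
      (E y c ↔ s) ∧ (E y d ↔ t)
    · obtain ⟨y, c, d, hc, hd', hcd, ncd, h1, h2⟩ := hex
      refine ⟨(sepSet (UG E) c d).ncard, fun x a b ha hb hab nab h3 h4 => ?_⟩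
      obtain ⟨ψ, -, rfl, rfl⟩ := hh.exists_cherry hd ha hb hab nab hc hd' hcd ncd
        (h3.trans h1.symm) (h4.trans h2.symm)
      exact ncard_sepSet_le (ugIso ψ) a b
    · exact ⟨0, fun x a b ha hb hab nab h3 h4 =>
        absurd ⟨x, a, b, ha, hb, hab, nab, h3, h4⟩ hex⟩
  choose M hM using key
  refine ⟨max (max (M True True) (M True False)) (max (M False True) (M False False)),
    fun x a b ha hb hab nab => ?_⟩
  by_cases h1 : E x a <;> by_cases h2 : E x b
  · exact (hM True True x a b ha hb hab nab (by simpa) (by simpa)).trans (by simp)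
  · exact (hM True False x a b ha hb hab nab (by simpa) (by simpa)).trans (by simp)
  · exact (hM False True x a b ha hb hab nab (by simpa) (by simpa)).trans (by simp)
  · exact (hM False False x a b ha hb hab nab (by simpa) (by simpa)).trans (by simp)

/-- If every edge lies in an optimal separator and some optimal separator containing `x`
separates two neighbours of `x`, then some two neighbours of `x` are separated by arbitrarily
many optimal separators. -/
lemma exists_many_sepSet {G : SimpleGraph V}
    (hedge : ∀ x y, G.Adj x y → ∃ S, OptSep G S ∧ x ∈ S ∧ y ∈ S) {S₀ : Set V}
    {x a : V} (hx : x ∈ S₀) (j : ℕ)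
    (hb : ∃ b, G.Adj x b ∧ S₀ ∈ sepSet G a b) :
    ∃ S b, x ∈ S ∧ G.Adj x b ∧ S ∈ sepSet G a b ∧
      ∃ F : Finset (Set V), F.card = j ∧ ∀ T ∈ F, ∀ w, LinkedOff G S b w → T ∈ sepSet G a w := by
  induction j with
  | zero =>
    obtain ⟨b, hb, hab⟩ := hb
    exact ⟨S₀, b, hx, hb, hab, ∅, rfl, by simp⟩
  | succ j ih =>
    obtain ⟨S, b, hxS, hxb, ⟨hS, hSa, hSb, nab⟩, F, hF, hFs⟩ := ih
    obtain ⟨S', hS', hxS', hbS'⟩ := hedge x b hxb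
    have hno := hS.not_crosses hS'
    unfold Crosses at hno
    push Not at hno
    obtain ⟨v, hv, hvS⟩ := hno
    have hav : ∀ w, LinkedOff G S' v w → w ∉ S := fun w hw hwS => hvS w hwS hw
    obtain ⟨c, hvc, hcb⟩ := hS'.1.exists_adj hv hbS'
    obtain ⟨b', hvb', hb'x⟩ := hS'.1.exists_adj hv hxS'
    have hbv : LinkedOff G S b v := ((hvc.of_avoids hav).step hcb hSb.notMem).symm
    have hsub : ∀ w, LinkedOff G S' b' w → LinkedOff G S b w := fun w hw =>
      hbv.trans ((hvb'.trans hw).of_avoids hav)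
    have haS' : IsBig G S' a := hSa.of_avoids fun w hw hwS' =>
      nab (hw.trans (hS.linked hS' hbS' hwS' hSb.notMem hw.right).symm)
    have hsep : ∀ w, LinkedOff G S' b' w → S' ∈ sepSet G a w := fun w hw =>
      ⟨hS', haS', (hv.of_linked hvb').of_linked hw, fun hc =>
        nab (hsub a (hw.trans hc.symm)).symm⟩
    refine ⟨S', b', hxS', hb'x.symm, hsep b' (.refl hvb'.right), F.cons S' ?_, ?_, ?_⟩
    · intro hc
      exact (hFs S' hc b (.refl hSb.notMem)).2.2.1.notMem hbS'
    · rw [Finset.card_cons, hF]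
    · intro T hT w hw
      rcases Finset.mem_cons.1 hT with rfl | hT
      exacts [hsep w hw, hFs T hT w (hsub w hw)]

/-- Optimal separators are independent sets. -/
lemma OptSep.not_adj (hd : IsDigraph E) (hh : DigraphCHom E) {S : Set V}
    (hS : OptSep (UG E) S) {x y : V} (hx : x ∈ S) (hy : y ∈ S) : ¬ (UG E).Adj x y := by
  intro hxy
  have hedge : ∀ a b, (UG E).Adj a b → ∃ T, OptSep (UG E) T ∧ a ∈ T ∧ b ∈ T := by
    intro a b hab
    by_cases h : E x y ↔ E a b
    · obtain ⟨ψ, rfl, rfl⟩ := hh.exists_edge hd hxy hab h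
      exact ⟨_, hS.map (ugIso ψ), ⟨x, hx, rfl⟩, ⟨y, hy, rfl⟩⟩
    · obtain ⟨ψ, rfl, rfl⟩ := hh.exists_edge hd hxy hab.symm
        (by have := hd.rev_iff hab; tauto)
      exact ⟨_, hS.map (ugIso ψ), ⟨y, hy, rfl⟩, ⟨x, hx, rfl⟩⟩
  obtain ⟨u, hu, -⟩ := hS.1.exists_not_linked x
  obtain ⟨v, hv, huv⟩ := hS.1.exists_not_linked u
  obtain ⟨a, ha, hax⟩ := hS.1.exists_adj hu hx
  obtain ⟨b, hb, hbx⟩ := hS.1.exists_adj hv hx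
  obtain ⟨M, hM⟩ := exists_ncard_sepSet_le hd hh
  obtain ⟨T, c, hxT, hxc, ⟨hT, hTa, hTc, nac⟩, F, hF, hFs⟩ := exists_many_sepSet hedge hx
    (M + 1) ⟨b, hbx.symm, hS, hu.of_linked ha, hv.of_linked hb,
      fun hc => huv ((ha.trans hc).trans hb.symm)⟩
  have h1 := hM x a c hax.symm hxc (by rintro rfl; exact nac (.refl hTa.notMem))
    (fun hc => nac (.edge hc hTa.notMem hTc.notMem))
  have h2 : (F : Set (Set V)).ncard ≤ (sepSet (UG E) a c).ncard :=
    Set.ncard_le_ncard (fun T hT => hFs T hT c (.refl hTc.notMem)) (finite_sepSet _ _)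
  rw [Set.ncard_coe_finset, hF] at h2
  omega

/-- In a C-homogeneous digraph with a triangle, every neighbour `a` of `x` has a common
neighbour with `x` lying on the other side of `x`. -/
lemma exists_third (hd : IsDigraph E) (hh : DigraphCHom E) (ht : HasTriangle E) {x a : V}
    (hxa : (UG E).Adj x a) : ∃ c, (UG E).Adj x c ∧ (UG E).Adj a c ∧ (E x c ↔ ¬ E x a) := by
  obtain ⟨p, q, r, hpq, hqr, hpr⟩ : ∃ p q r, E p q ∧ E q r ∧ (UG E).Adj p r := by
    obtain ⟨p, q, r, h1, h2, h3⟩ := ht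
    rcases hd.adj_iff.1 h1 with e1 | e1 <;> rcases hd.adj_iff.1 h2 with e2 | e2
    · exact ⟨p, q, r, e1, e2, h3⟩
    · rcases hd.adj_iff.1 h3 with e3 | e3
      · exact ⟨p, r, q, e3, e2, h1⟩
      · exact ⟨r, p, q, e3, e1, h2.symm⟩
    · rcases hd.adj_iff.1 h3 with e3 | e3
      · exact ⟨q, p, r, e1, e3, h2⟩
      · exact ⟨q, r, p, e2, e3, h1.symm⟩
    · exact ⟨r, q, p, e2, e1, h3.symm⟩
  have apq := hd.adj_iff.2 (Or.inl hpq)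
  have aqr := hd.adj_iff.2 (Or.inl hqr)
  by_cases h : E x a
  · obtain ⟨ψ, rfl, rfl⟩ := hh.exists_edge hd aqr hxa (iff_of_true hqr h)
    refine ⟨ψ p, (ugIso ψ).map_adj_iff.2 apq.symm, (ugIso ψ).map_adj_iff.2 hpr.symm,
      iff_of_false ?_ (not_not.2 h)⟩
    exact fun hc => hd.2 _ _ hpq (ψ.map_rel_iff.1 hc)
  · have h' := (hd.rev_iff hxa).2 h
    obtain ⟨ψ, rfl, rfl⟩ := hh.exists_edge hd apq hxa.symm (iff_of_true hpq h')
    exact ⟨ψ r, (ugIso ψ).map_adj_iff.2 aqr, (ugIso ψ).map_adj_iff.2 hpr,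
      iff_of_true (ψ.map_rel_iff.2 hqr) h⟩

lemma OptSep.exists_nbr (hd : IsDigraph E) (hh : DigraphCHom E) (ht : HasTriangle E)
    {S : Set V} (hS : OptSep (UG E) S) {x a : V} (hx : x ∈ S) (hxa : (UG E).Adj x a) (s : Prop) :
    ∃ c, (UG E).Adj x c ∧ LinkedOff (UG E) S a c ∧ (E x c ↔ s) := by
  have hnS : ∀ c, (UG E).Adj x c → c ∉ S := fun c hc hcS => hS.not_adj hd hh hx hcS hc
  by_cases h : E x a ↔ s
  · exact ⟨a, hxa, .refl (hnS a hxa), h⟩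
  · obtain ⟨c, h1, h2, h3⟩ := exists_third hd hh ht hxa
    exact ⟨c, h1, .edge h2 (hnS a hxa) (hnS c h1), by tauto⟩

lemma OptSep.exists_nbr_of_isBig (hd : IsDigraph E) (hh : DigraphCHom E) (ht : HasTriangle E)
    {S : Set V} (hS : OptSep (UG E) S) {x u : V} (hx : x ∈ S) (hu : IsBig (UG E) S u) (s : Prop) :
    ∃ c, (UG E).Adj x c ∧ LinkedOff (UG E) S u c ∧ (E x c ↔ s) := by
  obtain ⟨a, ha, hax⟩ := hS.1.exists_adj hu hx
  obtain ⟨c, h1, h2, h3⟩ := hS.exists_nbr hd hh ht hx hax.symm s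
  exact ⟨c, h1, ha.trans h2, h3⟩

lemma dist_ugIso_le (hG : (UG E).Connected) (ψ : E ≃r E) (x y : V) :
    (UG E).dist (ψ x) (ψ y) ≤ (UG E).dist x y := by
  obtain ⟨p, hp⟩ := hG.exists_walk_length_eq_dist x y
  rw [← hp, ← p.length_map (ugIso ψ).toHom]
  exact SimpleGraph.dist_le _

lemma dist_ugIso (hG : (UG E).Connected) (ψ : E ≃r E) (x y : V) :
    (UG E).dist (ψ x) (ψ y) = (UG E).dist x y := by
  refine (dist_ugIso_le hG ψ x y).antisymm ?_
  simpa using dist_ugIso_le hG ψ.symm (ψ x) (ψ y)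

/-- Optimal separators have at most one element. -/
lemma OptSep.subsingleton (hd : IsDigraph E) (hh : DigraphCHom E) (ht : HasTriangle E)
    (hG : (UG E).Connected) {S₀ : Set V} (hS₀ : OptSep (UG E) S₀) : S₀.Subsingleton := by
  classical
  by_contra hns
  rw [Set.not_subsingleton_iff] at hns
  obtain ⟨x₀, hx₀, y₀, hy₀, hxy₀⟩ := hns
  obtain ⟨k, ⟨S, x, y, hS, hx, hy, hxy, rfl⟩, hmin⟩ := WellFounded.has_min (measure id).wf
    {k | ∃ S x y, OptSep (UG E) S ∧ x ∈ S ∧ y ∈ S ∧ x ≠ y ∧ (UG E).dist x y = k}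
    ⟨_, S₀, x₀, y₀, hS₀, hx₀, hy₀, hxy₀, rfl⟩
  have hfar : ∀ s ∈ S, x ≠ s → (UG E).dist x y ≤ (UG E).dist x s := fun s hs hxs =>
    not_lt.1 (hmin _ ⟨S, x, s, hS, hx, hs, hxs, rfl⟩)
  obtain ⟨q, q0, qk, hq⟩ := exists_isGeodesic hG x y
  generalize hk : (UG E).dist x y = k at *
  have hk2 : 2 ≤ k := by
    have h0 := (hG.dist_eq_zero_iff (u := x) (v := y)).1
    have h1 := (SimpleGraph.dist_eq_one_iff_adj (G := UG E) (u := x) (v := y)).1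
    have h2 := hS.not_adj hd hh hx hy
    by_contra hlt
    obtain h | h : k = 0 ∨ k = 1 := by omega
    exacts [hxy (h0 (hk.trans h)), h2 (h1 (hk.trans h))]
  have a01 : (UG E).Adj x (q 1) := q0 ▸ hq.1 0 (by omega)
  have hq1 : q 1 ∉ S := fun hc => hS.not_adj hd hh hx hc a01
  obtain ⟨u, hu, huq⟩ := hS.1.exists_not_linked (q 1)
  obtain ⟨c, hxc, hqc, hc⟩ := hS.exists_nbr hd hh ht hx a01 (E (q 1) (q 2))
  obtain ⟨a, hxa, hua, ha⟩ := hS.exists_nbr_of_isBig hd hh ht hx hu (¬ E (q 0) (q 1))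
  obtain ⟨ψ, ψ1, ψ2⟩ := hh.exists_edge hd (hq.1 1 (by omega)) hxc hc.symm
  have hdist : ∀ i, i + 1 ≤ k → (UG E).dist x (ψ (q (i + 1))) = i := by
    intro i hi
    rw [← ψ1, dist_ugIso hG, add_comm]
    exact hq.dist_eq hG 1 i (by omega)
  have hnS : ∀ i, i + 2 ≤ k → ψ (q (i + 2)) ∉ S := by
    intro i hi hc
    have h1 := hdist (i + 1) hi
    have h2 := hfar _ hc
    have h3 : x ≠ ψ (q (i + 2)) := by
      intro h
      rw [add_assoc, one_add_one_eq_two, ← h, SimpleGraph.dist_self] at h1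
      omega
    have := h2 h3
    rw [add_assoc, one_add_one_eq_two] at h1
    omega
  have hlink : ∀ i, i + 2 ≤ k → LinkedOff (UG E) S (q 1) (ψ (q (i + 2))) := by
    intro i hi
    induction i with
    | zero => simpa [ψ2] using hqc
    | succ i ih =>
      exact (ih (by omega)).step ((ugIso ψ).map_adj_iff.2 (hq.1 _ (by omega))) (hnS _ hi)
  obtain ⟨m, rfl⟩ := Nat.exists_eq_add_of_le' hk2
  have hzS := hnS m le_rfl
  have hzl := hlink m le_rfl
  have hxz : (UG E).dist x (ψ (q (m + 2))) = m + 1 := hdist (m + 1) le_rfl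
  have hnl : ¬ LinkedOff (UG E) S a (ψ (q (m + 2))) := fun hc =>
    huq (hzl.trans (hc.symm.trans hua.symm))
  have hfar' : m + 2 ≤ (UG E).dist a (ψ (q (m + 2))) := by
    obtain ⟨p, hp⟩ := hG.exists_walk_length_eq_dist a (ψ (q (m + 2)))
    obtain ⟨s, hs, hsS⟩ : ∃ s ∈ p.support, s ∈ S := by
      by_contra! hno
      exact hnl ⟨p, hno⟩
    have h1 : p.length = (p.takeUntil s hs).length + (p.dropUntil s hs).length := by
      rw [← SimpleGraph.Walk.length_append, p.take_spec]
    have h2 := SimpleGraph.dist_le (p.takeUntil s hs)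
    have h3 := SimpleGraph.dist_le (p.dropUntil s hs)
    have h4 := SimpleGraph.dist_eq_one_iff_adj.2 hxa
    rw [← hp]
    by_cases hsx : x = s
    · subst hsx
      rw [SimpleGraph.dist_comm] at h4
      omega
    · have h5 := hfar s hsS hsx
      have h6 := hG.dist_triangle (u := x) (v := a) (w := s)
      have h7 : (UG E).dist s (ψ (q (m + 2))) ≠ 0 := by
        rw [Ne, hG.dist_eq_zero_iff]
        rintro rfl
        exact hzS hsS
      omega
  have hr : IsGeodesic (UG E) (m + 2) fun i => if i = 0 then a else ψ (q i) := by
    refine ⟨fun i hi => ?_, by simpa using hfar'⟩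
    rcases i with _ | i
    · simpa [ψ1] using hxa.symm
    · simpa using (ugIso ψ).map_adj_iff.2 (hq.1 _ hi)
  obtain ⟨χ, hχ⟩ := hh.exists_geodesic hd hG hq hr (by
    intro i hi
    rcases i with _ | i
    · have := hd.rev_iff hxa
      simp only [zero_add, if_true, one_ne_zero, if_false, ψ1]
      tauto
    · simp [ψ.map_rel_iff])
  have e0 : χ x = a := by simpa [q0] using hχ 0 (by omega)
  have ek : χ y = ψ (q (m + 2)) := by simpa [qk] using hχ (m + 2) le_rfl
  exact hnl (hS.linked (hS.map (ugIso χ)) ⟨x, hx, e0⟩ ⟨y, hy, ek⟩ hua.right hzS)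

/-- Every vertex separates its nonadjacent neighbours. -/
lemma adj_of_linkedOff (hd : IsDigraph E) (hh : DigraphCHom E) (ht : HasTriangle E)
    (hG : (UG E).Connected) (he : MoreThanOneEnd (UG E)) {x u v : V} (hu : (UG E).Adj x u)
    (hv : (UG E).Adj x v) (huv : u ≠ v) (hl : LinkedOff (UG E) {x} u v) : (UG E).Adj u v := by
  by_contra nuv
  obtain ⟨S, hS⟩ := exists_optSep he
  have hx : OptSep (UG E) {x} := by
    rcases (hS.subsingleton hd hh ht hG).eq_empty_or_singleton with rfl | ⟨s, rfl⟩
    · obtain ⟨⟨-, a, b, -, -, hab⟩, -⟩ := hS.1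
      obtain ⟨p⟩ := hG.preconnected a b
      exact absurd ⟨p, by simp⟩ hab
    · obtain ⟨ψ, rfl⟩ := hh.exists_vertex hd s x
      simpa using hS.map (ugIso ψ)
  obtain ⟨⟨-, a₀, b₀, ha₀, hb₀, hab₀⟩, -⟩ := hx.1
  obtain ⟨a, hxa, hla, ha⟩ := hx.exists_nbr_of_isBig hd hh ht rfl ha₀ (E x u)
  obtain ⟨b, hxb, hlb, hb⟩ := hx.exists_nbr_of_isBig hd hh ht rfl hb₀ (E x v)
  have hab : ¬ LinkedOff (UG E) {x} a b := fun h => hab₀ ((hla.trans h).trans hlb.symm)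
  obtain ⟨ψ, h1, h2, h3⟩ := hh.exists_cherry hd hxa hxb
    (by rintro rfl; exact hab (.refl hla.right)) (fun h => hab (.edge h hla.right hlb.right))
    hu hv huv nuv ha hb
  refine not_linkedOff_map (ugIso ψ) hab ?_
  rw [Set.image_singleton, ugIso_apply, ugIso_apply, ugIso_apply, h1, h2, h3]
  exact hl

end Digraph

/-- Interchanging two disjoint vertex sets by means of an automorphism. -/
lemma exists_swapIso {V : Type u} {G : SimpleGraph V} {P Q : Set V} (θ : G ≃g G)
    (hPQ : ∀ w ∈ P, w ∉ Q) (hθ : ∀ w, w ∈ P ↔ θ w ∈ Q)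
    (hout : ∀ p ∈ P, ∀ z, z ∉ P → z ∉ Q → (G.Adj p z ↔ G.Adj (θ p) z))
    (hin : ∀ p ∈ P, ∀ q ∈ P, (G.Adj p (θ q) ↔ G.Adj (θ p) q)) :
    ∃ σ : G ≃g G, (∀ p ∈ P, σ p = θ p) ∧ ∀ z, z ∉ P → z ∉ Q → σ z = z := by
  classical
  have hPQ' : ∀ w ∈ P, θ w ∉ P := fun w hw h => hPQ _ h ((hθ w).1 hw)
  have hQ : ∀ q ∈ Q, ∃ p ∈ P, θ p = q := fun q hq =>
    ⟨θ.symm q, (hθ _).2 (by simpa using hq), by simp⟩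
  let f : V → V := fun z => if z ∈ P then θ z else if z ∈ Q then θ.symm z else z
  have fP : ∀ p ∈ P, f p = θ p := fun p hp => by simp [f, hp]
  have fQ : ∀ p ∈ P, f (θ p) = p := fun p hp => by simp [f, hPQ' p hp, (hθ p).1 hp]
  have fo : ∀ z, z ∉ P → z ∉ Q → f z = z := fun z h1 h2 => by simp [f, h1, h2]
  have hinv : Function.Involutive f := by
    intro z
    by_cases h1 : z ∈ P
    · rw [fP z h1, fQ z h1]
    · by_cases h2 : z ∈ Q
      · obtain ⟨p, hp, rfl⟩ := hQ z h2
        rw [fQ p hp, fP p hp]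
      · rw [fo z h1 h2, fo z h1 h2]
  have hadj : ∀ a b, G.Adj a b → G.Adj (f a) (f b) := by
    have hPo : ∀ p ∈ P, ∀ b, b ∉ P → G.Adj p b → G.Adj (f p) (f b) := by
      intro p hp b hb h
      by_cases hbQ : b ∈ Q
      · obtain ⟨q, hq, rfl⟩ := hQ b hbQ
        rw [fP p hp, fQ q hq]
        exact (hin p hp q hq).1 h
      · rw [fP p hp, fo b hb hbQ]
        exact (hout p hp b hb hbQ).1 h
    have hQo : ∀ p ∈ P, ∀ b, b ∉ P → G.Adj (θ p) b → G.Adj (f (θ p)) (f b) := by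
      intro p hp b hb h
      by_cases hbQ : b ∈ Q
      · obtain ⟨q, hq, rfl⟩ := hQ b hbQ
        rw [fQ p hp, fQ q hq]
        exact θ.map_adj_iff.1 h
      · rw [fQ p hp, fo b hb hbQ]
        exact (hout p hp b hb hbQ).2 h
    intro a b h
    by_cases ha : a ∈ P <;> by_cases hb : b ∈ P
    · rw [fP a ha, fP b hb]
      exact θ.map_adj_iff.2 h
    · exact hPo a ha b hb h
    · exact (hPo b hb a ha h.symm).symm
    · by_cases haQ : a ∈ Q
      · obtain ⟨p, hp, rfl⟩ := hQ a haQ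
        exact hQo p hp b hb h
      · by_cases hbQ : b ∈ Q
        · obtain ⟨p, hp, rfl⟩ := hQ b hbQ
          exact (hQo p hp a ha h.symm).symm
        · rwa [fo a ha haQ, fo b hb hbQ]
  refine ⟨⟨hinv.toPerm, fun {a b} => ⟨fun h => ?_, hadj a b⟩⟩, fP, fo⟩
  have h2 := hadj _ _ h
  simp only [Function.Involutive.coe_toPerm, hinv a, hinv b] at h2
  exact h2

section Extension

variable {V : Type u} {E : V → V → Prop}

lemma linkedOff_ugIso_iff (ψ : E ≃r E) {x a b : V} :
    LinkedOff (UG E) {ψ x} (ψ a) (ψ b) ↔ LinkedOff (UG E) {x} a b := by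
  have h1 := LinkedOff.map (T := {x}) (u := a) (v := b) (ugIso ψ)
  have h2 := not_linkedOff_map (T := {x}) (u := a) (v := b) (ugIso ψ)
  rw [Set.image_singleton] at h1 h2
  exact ⟨not_imp_not.1 h2, h1⟩

/-- Every vertex is linked to `x` off one of two adjacent neighbours of `x`. -/
lemma linkedOff_or {G : SimpleGraph V} (hG : G.Connected) {x v v' : V} (hv : G.Adj x v)
    (hv' : G.Adj x v') (hvv : v ≠ v') (w : V) :
    LinkedOff G {v} x w ∨ LinkedOff G {v'} x w := by
  obtain ⟨p⟩ := hG.preconnected w x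
  induction p with
  | nil => exact Or.inl (.refl hv.ne)
  | @cons a b x hab p ih =>
    by_cases h : a = v
    · subst h
      exact Or.inr (.edge hv hv'.ne hvv)
    by_cases h' : a = v'
    · subst h'
      exact Or.inl (.edge hv' hv.ne hvv.symm)
    exact (ih hv hv').imp (fun hl => hl.step hab.symm h) (fun hl => hl.step hab.symm h')

/-- Two adjacent neighbours `v`, `v'` of `x` can be interchanged while fixing a connected set
containing `x`. -/
lemma exists_fix_of_adj (hd : IsDigraph E) (hh : DigraphCHom E) (ht : HasTriangle E)
    (hG : (UG E).Connected) (he : MoreThanOneEnd (UG E)) {Z : Set V} {x v v' : V}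
    (hZ : ∀ z ∈ Z, LinkedOff (UG E) Zᶜ x z) (hvZ : v ∉ Z) (hvZ' : v' ∉ Z)
    (hxv : (UG E).Adj x v) (hxv' : (UG E).Adj x v') (hvv : (UG E).Adj v v') :
    ∃ σ : UG E ≃g UG E, (∀ z ∈ Z, σ z = z) ∧ σ v = v' := by
  wlog hE : E v v' generalizing v v'
  · obtain ⟨σ, h1, h2⟩ := this hvZ' hvZ hxv' hxv hvv.symm ((hd.rev_iff hvv).2 hE)
    refine ⟨σ.symm, fun z hz => ?_, ?_⟩
    · rw [← h1 z hz, σ.symm_apply_apply, h1 z hz]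
    · rw [← h2, σ.symm_apply_apply]
  obtain ⟨c, hc1, hc2, hc⟩ := exists_third hd hh ht hvv.symm
  have hE' : E v' c := hc.2 (hd.2 _ _ hE)
  obtain ⟨θ, θv, θv'⟩ := hh.exists_edge hd hvv hc1 (iff_of_true hE hE')
  have hl1 : LinkedOff (UG E) {v} x v' := .edge hxv' hxv.ne hvv.ne'
  have hl2 : LinkedOff (UG E) {v'} x v := .edge hxv hxv'.ne hvv.ne
  have hl3 : LinkedOff (UG E) {v'} v c := .edge hc2 hvv.ne hc1.ne'
  have hθ : ∀ w, LinkedOff (UG E) {v} x w ↔ LinkedOff (UG E) {v'} x (θ w) := by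
    intro w
    have h := linkedOff_ugIso_iff θ (x := v) (a := v') (b := w)
    rw [θv, θv'] at h
    have h2 : LinkedOff (UG E) {v} x w ↔ LinkedOff (UG E) {v} v' w :=
      ⟨hl1.symm.trans, hl1.trans⟩
    rw [h2, ← h]
    exact ⟨fun h => (hl2.trans hl3).trans h, fun h => (hl2.trans hl3).symm.trans h⟩
  have hself : ∀ {a}, ¬ LinkedOff (UG E) {a} x a := fun h => h.right rfl
  have hedge : ∀ {a p z}, ¬ LinkedOff (UG E) {a} x p → LinkedOff (UG E) {a} x z →
      (UG E).Adj p z → p = a := by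
    intro a p z hp hz h
    by_contra hne
    exact hp (hz.step h.symm hne)
  have hdis := linkedOff_or hG hxv hxv' hvv.ne
  have hstar : ∀ z, LinkedOff (UG E) {v} x z → LinkedOff (UG E) {v'} x z →
      ((UG E).Adj v z ↔ (UG E).Adj v' z) := by
    intro z h1 h2
    constructor
    · intro h
      refine adj_of_linkedOff hd hh ht hG he hvv h ?_ (hl1.symm.trans h1)
      rintro rfl
      exact hself h2
    · intro h
      refine adj_of_linkedOff hd hh ht hG he hvv.symm h ?_ (hl2.symm.trans h2)
      rintro rfl
      exact hself h1
  obtain ⟨σ, s1, s2⟩ := exists_swapIso (P := {w | ¬ LinkedOff (UG E) {v} x w})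
    (Q := {w | ¬ LinkedOff (UG E) {v'} x w}) (ugIso θ) (fun w hw hw' => (hdis w).elim hw hw')
    (fun w => not_congr (hθ w)) (fun p hp z hz hz' => by
      have hz := not_not.1 hz
      have hz' := not_not.1 hz'
      by_cases h : p = v
      · subst h
        rw [ugIso_apply, θv]
        exact hstar z hz hz'
      · refine iff_of_false (fun hc => h (hedge hp hz hc)) fun hc => h ?_
        refine θ.injective ((hedge (mt (hθ p).2 hp) hz' hc).trans θv.symm)) (fun p hp q hq => by
      have key : ∀ p q, ¬ LinkedOff (UG E) {v} x p → ¬ LinkedOff (UG E) {v} x q →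
          (UG E).Adj p (θ q) → p = v ∧ q = v := by
        intro p q hp hq h
        have hq' := mt (hθ q).2 hq
        exact ⟨hedge hp ((hdis _).resolve_right hq') h,
          θ.injective ((hedge hq' ((hdis _).resolve_left hp) h.symm).trans θv.symm)⟩
      constructor
      · intro h
        obtain ⟨rfl, rfl⟩ := key p q hp hq h
        exact h.symm
      · intro h
        obtain ⟨rfl, rfl⟩ := key q p hq hp h.symm
        exact h.symm)
  refine ⟨σ, fun z hz => s2 z (not_not.2 ?_) (not_not.2 ?_), (s1 v hself).trans θv⟩
  · exact (hZ z hz).mono (by simpa using hvZ)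
  · exact (hZ z hz).mono (by simpa using hvZ')

/-- A connected set `Z` containing `x` avoids the components of the complement of `x` containing
nonadjacent neighbours of `x` with the same neighbours in `Z`. -/
lemma not_linkedOff_of_mem (hd : IsDigraph E) (hh : DigraphCHom E) (ht : HasTriangle E)
    (hG : (UG E).Connected) (he : MoreThanOneEnd (UG E)) {Z : Set V} {x v v' : V}
    (hZ : ∀ z ∈ Z, LinkedOff (UG E) Zᶜ x z) (hvZ : v ∉ Z)
    (hxv : (UG E).Adj x v) (hxv' : (UG E).Adj x v') (hne : v ≠ v') (hvv : ¬ (UG E).Adj v v')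
    (hN : ∀ z ∈ Z, (UG E).Adj v z → (UG E).Adj v' z) :
    ∀ z ∈ Z, ¬ LinkedOff (UG E) {x} v z := by
  intro z hz hl
  obtain ⟨a, haZ, hxa, hva⟩ : ∃ a ∈ Z, (UG E).Adj x a ∧ LinkedOff (UG E) {x} v a := by
    by_contra! hno
    refine (LinkedOff.mem_of_closed (X := {z | z ∈ Z ∧ LinkedOff (UG E) {x} v z}) ?_
      (hZ z hz).symm ⟨hz, hl⟩).2.right rfl
    rintro a ⟨haZ, ha⟩ b hab hb
    refine ⟨not_not.1 hb, ha.step hab ?_⟩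
    rintro rfl
    exact hno a haZ hab.symm ha
  have h1 : (UG E).Adj v a := adj_of_linkedOff hd hh ht hG he hxv hxa
    (by rintro rfl; exact hvZ haZ) hva
  exact hvv (adj_of_linkedOff hd hh ht hG he hxv hxv' hne
    (hva.step (hN a haZ h1).symm hxv'.ne'))

/-- Two neighbours of `x` with the same neighbours in a connected set `Z` containing `x` are
conjugate under the pointwise stabilizer of `Z`. -/
lemma exists_fix (hd : IsDigraph E) (hh : DigraphCHom E) (ht : HasTriangle E)
    (hG : (UG E).Connected) (he : MoreThanOneEnd (UG E)) {Z : Set V} {x v v' : V} (hxZ : x ∈ Z)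
    (hZ : ∀ z ∈ Z, LinkedOff (UG E) Zᶜ x z) (hvZ : v ∉ Z) (hvZ' : v' ∉ Z)
    (hxv : (UG E).Adj x v) (hN : ∀ z ∈ Z, ((UG E).Adj v z ↔ (UG E).Adj v' z)) :
    ∃ σ : UG E ≃g UG E, (∀ z ∈ Z, σ z = z) ∧ σ v = v' := by
  have hxv' : (UG E).Adj x v' := ((hN x hxZ).1 hxv.symm).symm
  rcases eq_or_ne v v' with rfl | hne
  · exact ⟨.refl, fun _ _ => rfl, rfl⟩
  by_cases hvv : (UG E).Adj v v'
  · exact exists_fix_of_adj hd hh ht hG he hZ hvZ hvZ' hxv hxv' hvv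
  obtain ⟨w, hxw, hw, hwE⟩ : ∃ w, (UG E).Adj x w ∧ (w = v ∨ (UG E).Adj v w) ∧
      (E x w ↔ E x v') := by
    by_cases h : E x v ↔ E x v'
    · exact ⟨v, hxv, Or.inl rfl, h⟩
    · obtain ⟨c, h1, h2, h3⟩ := exists_third hd hh ht hxv
      exact ⟨c, h1, Or.inr h2, by tauto⟩
  obtain ⟨θ, θx, θw⟩ := hh.exists_edge hd hxw hxv' hwE
  have hwv : LinkedOff (UG E) {x} w v := by
    rcases hw with rfl | hw
    exacts [.refl hxv.ne', .edge hw.symm hxw.ne' hxv.ne']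
  have hθ : ∀ y, LinkedOff (UG E) {x} w y ↔ LinkedOff (UG E) {x} v' (θ y) := by
    intro y
    have h := linkedOff_ugIso_iff θ (x := x) (a := w) (b := y)
    rw [θx, θw] at h
    exact h.symm
  have hedge : ∀ {a p z}, LinkedOff (UG E) {x} a p → ¬ LinkedOff (UG E) {x} a z →
      (UG E).Adj p z → z = x := by
    intro a p z hp hz h
    by_contra hne
    exact hz (hp.step h hne)
  have hdis : ∀ y, LinkedOff (UG E) {x} w y → ¬ LinkedOff (UG E) {x} v' y := fun y h1 h2 =>
    hvv (adj_of_linkedOff hd hh ht hG he hxv hxv' hne ((hwv.symm.trans h1).trans h2.symm))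
  have hfar : ∀ p q, LinkedOff (UG E) {x} w p → LinkedOff (UG E) {x} w q →
      ¬ (UG E).Adj p (θ q) := fun p q hp hq h =>
    ((hθ q).1 hq).right (hedge hp (fun hc => hdis _ hc ((hθ q).1 hq)) h)
  obtain ⟨σ, s1, s2⟩ := exists_swapIso (P := {y | LinkedOff (UG E) {x} w y})
    (Q := {y | LinkedOff (UG E) {x} v' y}) (ugIso θ) hdis hθ (fun p hp z hz hz' => by
      constructor
      · intro h
        obtain rfl := hedge hp hz h
        have := (ugIso θ).map_adj_iff.2 h
        rwa [ugIso_apply θ z, θx] at this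
      · intro h
        obtain rfl := hedge ((hθ p).1 hp) hz' h
        refine (ugIso θ).map_adj_iff.1 ?_
        rwa [ugIso_apply θ z, θx])
    (fun p hp q hq => iff_of_false (hfar p q hp hq) fun h => hfar q p hq hp h.symm)
  have hfix : ∀ z ∈ Z, σ z = z := fun z hz => s2 z
    (fun h => not_linkedOff_of_mem hd hh ht hG he hZ hvZ hxv hxv' hne hvv
      (fun z hz => (hN z hz).1) z hz (hwv.symm.trans h))
    (not_linkedOff_of_mem hd hh ht hG he hZ hvZ' hxv' hxv hne.symm (fun h => hvv h.symm)
      (fun z hz => (hN z hz).2) z hz)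
  have hσ : σ v = θ v := s1 v hwv
  rcases hw with rfl | hw
  · exact ⟨σ, hfix, hσ.trans θw⟩
  have h1 : (UG E).Adj x (σ v) := by
    have := σ.map_adj_iff.2 hxv
    rwa [hfix x hxZ] at this
  have h2 : (UG E).Adj (σ v) v' := by
    rw [hσ, ← θw]
    exact (ugIso θ).map_adj_iff.2 hw
  obtain ⟨τ, t1, t2⟩ := exists_fix_of_adj hd hh ht hG he hZ
    (fun h => hvZ (by rwa [σ.injective (hfix _ h)] at h)) hvZ' h1 hxv' h2
  refine ⟨σ.trans τ, fun z hz => ?_, t2⟩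
  rw [RelIso.trans_apply, hfix z hz, t1 z hz]

/-- A connected C-homogeneous digraph with a triangle and more than one end has a C-homogeneous
underlying graph. -/
lemma graphCHom_UG (hd : IsDigraph E) (hh : DigraphCHom E) (ht : HasTriangle E)
    (hG : (UG E).Connected) (he : MoreThanOneEnd (UG E)) : GraphCHom (UG E) := by
  intro X Y hX _ hconn φ hφ
  obtain ⟨⟨x, hx⟩⟩ := hconn.nonempty
  have key : ∀ n, n < X.ncard → ∃ Z ⊆ X, Z.ncard = n + 1 ∧ x ∈ Z ∧
      (∀ z ∈ Z, LinkedOff (UG E) Zᶜ x z) ∧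
      ∃ ψ : UG E ≃g UG E, ∀ a : X, a.1 ∈ Z → ψ a.1 = (φ a).1 := by
    intro n hn
    induction n with
    | zero =>
      obtain ⟨ψ, hψ⟩ := hh.exists_vertex hd x (φ ⟨x, hx⟩).1
      refine ⟨{x}, by simpa using hx, by simp, rfl, ?_, ugIso ψ, ?_⟩
      · rintro z rfl
        exact .refl (not_not.2 rfl)
      · rintro ⟨a, ha⟩ rfl
        exact hψ
    | succ n ih =>
      obtain ⟨Z, hZX, hcard, hxZ, hZ, ψ, hψ⟩ := ih (by omega)
      obtain ⟨z, hz, v, hzv, hvX, hvZ⟩ : ∃ z ∈ Z, ∃ v, (UG E).Adj z v ∧ v ∈ X ∧ v ∉ Z := by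
        by_contra! hno
        have : X ⊆ Z := fun a ha => (linkedOff_of_connected hconn hx ha).mem_of_closed
          (fun c hc b hcb hb => hno c hc b hcb (not_not.1 hb)) hxZ
        have := Set.ncard_le_ncard this (hX.subset hZX)
        omega
      have e : ∀ a : X, ψ (ψ.symm (φ a).1) = (φ a).1 := fun a => ψ.apply_symm_apply _
      obtain ⟨σ, s1, s2⟩ := exists_fix hd hh ht hG he hz
        (fun a ha => (hZ z hz).symm.trans (hZ a ha)) hvZ (v' := ψ.symm (φ ⟨v, hvX⟩).1)
        (fun hc => by
          have h1 := hψ ⟨_, hZX hc⟩ hc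
          rw [e] at h1
          have h2 := congrArg Subtype.val (φ.injective (Subtype.ext h1))
          simp only at h2
          exact hvZ (h2 ▸ hc)) hzv
        (fun a ha => by
          rw [hφ ⟨v, hvX⟩ ⟨a, hZX ha⟩, ← ψ.map_adj_iff (v := ψ.symm _), e, hψ ⟨a, hZX ha⟩ ha])
      have hsub : (insert v Z)ᶜ ⊆ Zᶜ := Set.compl_subset_compl.2 (Set.subset_insert _ _)
      refine ⟨insert v Z, Set.insert_subset hvX hZX, ?_, Or.inr hxZ, ?_, σ.trans ψ, ?_⟩
      · rw [Set.ncard_insert_of_notMem hvZ (hX.subset hZX), hcard]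
      · rintro a (rfl | ha)
        · exact ((hZ z hz).mono hsub).step hzv (not_not.2 (Or.inl rfl))
        · exact (hZ a ha).mono hsub
      · rintro ⟨a, haX⟩ (rfl | ha)
        · rw [RelIso.trans_apply, s2, e]
        · rw [RelIso.trans_apply, s1 a ha]
          exact hψ ⟨a, haX⟩ ha
  have hpos : 0 < X.ncard := (Set.ncard_pos hX).2 ⟨x, hx⟩
  obtain ⟨Z, hZX, hcard, -, -, ψ, hψ⟩ := key (X.ncard - 1) (by omega)
  have hZ : Z = X := Set.eq_of_subset_of_ncard_le hZX (by omega) hX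
  exact ⟨ψ, fun a => hψ a (hZ ▸ a.2)⟩

end Extension

/-- A connected C-homogeneous digraph of Type II with more than one end contains
no triangle. -/
theorem stmt_16 {V : Type u} (E : V → V → Prop) (hD : IsDigraph E)
    (hconn : (UG E).Connected) (hhom : DigraphCHom E)
    (htypeII : ¬ GraphCHom (UG E)) (hends : MoreThanOneEnd (UG E)) :
    ¬ HasTriangle E := by
  exact fun ht => htypeII (graphCHom_UG hD hhom ht hconn hends)
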